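/- arXiv:2605.29103 — 2 statements merged into one kernel-verified Lean document; each statement's English description precedes it below -/
import Mathlib

section
/- Let k be an algebraically closed field, n ≥ 3, and X a generating pattern on [n] whose GCD graph G_X is the n-cycle (distinct i and j adjacent if and only if j ≡ i ± 1 (mod n)). If V_X ≠ k^n, then n ≡ 2 (mod 4) and there exists a permutation π of [n] that is an automorphism of the n-cycle (a composition of a rotation and possibly a reflection) such that {(a_{π(1)},…,a_{π(n)}) : a ∈ V_X} equals either V(χ_1χ_3⋯χ_{n−1} + χ_2χ_4⋯χ_n) or V(χ_2χ_4⋯χ_n). -/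
open scoped Classical

noncomputable section

/-- A *generating pattern* on `[n]`: a finite set `X` of nonempty subsets of `Fin n`
such that for all `i ≠ j` there is `σ ∈ X` with `i ∈ σ` and `j ∉ σ`. -/
def IsGenPattern (n : ℕ) (X : Finset (Finset (Fin n))) : Prop :=
  (∀ σ ∈ X, σ.Nonempty) ∧ ∀ i j : Fin n, i ≠ j → ∃ σ ∈ X, i ∈ σ ∧ j ∉ σ

/-- Adjacency in the GCD graph of a generating pattern. -/
def GcdAdj {n : ℕ} (X : Finset (Finset (Fin n))) (i j : Fin n) : Prop :=
  i ≠ j ∧ ∃ σ ∈ X, i ∈ σ ∧ j ∈ σ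

/-- The neighborhood of a set of vertices in the GCD graph. -/
def Nbhd {n : ℕ} (X : Finset (Finset (Fin n))) (S : Finset (Fin n)) : Finset (Fin n) :=
  Finset.univ.filter fun j => ∃ i ∈ S, GcdAdj X i j

/-- The differential edge `d_{σ,i}` (from `σ ∪ {i}` to `σ`) exists. -/
def DiffEdge {n : ℕ} (X : Finset (Finset (Fin n))) (σ : Finset (Fin n)) (i : Fin n) : Prop :=
  i ∉ σ ∧ ∀ τ ∈ X, i ∈ τ → (τ ∩ σ).Nonempty

/-- The homotopy edge `h_{σ,i}` (from `σ` to `σ ∪ {i}`) exists. -/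
def HomEdge {n : ℕ} (X : Finset (Finset (Fin n))) (σ : Finset (Fin n)) (i : Fin n) : Prop :=
  i ∉ σ ∧ i ∉ Nbhd X σ

/-- `sign(σ, i) = (-1)^{|{j ∈ σ : j < i}|}`. -/
def edgeSign {n : ℕ} (σ : Finset (Fin n)) (i : Fin n) : ℤ :=
  (-1) ^ (σ.filter fun j => j < i).card

/-- The Taylor matrix of the generating pattern `X`, evaluated at the point `a : Fin n → k`. -/
def taylorMatrixAt {n : ℕ} {k : Type*} [Field k] (X : Finset (Finset (Fin n)))
    (a : Fin n → k) : Matrix (Finset (Fin n)) (Finset (Fin n)) k :=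
  fun r c =>
    (∑ i : Fin n, if c = insert i r ∧ DiffEdge X r i then (edgeSign r i : k) else 0) +
      ∑ i : Fin n, if r = insert i c ∧ HomEdge X c i then (edgeSign c i : k) * a i else 0

/-- The cohomological support variety `V_X ⊆ k^n`: the locus where all
`2^(n-1) × 2^(n-1)` minors of the Taylor matrix vanish. -/
def supportVariety {n : ℕ} (k : Type*) [Field k] (X : Finset (Finset (Fin n))) :
    Set (Fin n → k) :=
  { a | ∀ f g : Fin (2 ^ (n - 1)) → Finset (Fin n),
      Function.Injective f → Function.Injective g →
      ((taylorMatrixAt X a).submatrix f g).det = 0 }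

/-- The GCD graph of `X` is the `n`-cycle: distinct `i`, `j` are adjacent iff
`j ≡ i ± 1 (mod n)`. -/
def GcdGraphIsCycle (n : ℕ) [NeZero n] (X : Finset (Finset (Fin n))) : Prop :=
  ∀ i j : Fin n, GcdAdj X i j ↔ (j = i + 1 ∨ i = j + 1)


/-! ### Linear algebra -/

theorem sum_sub {ι M : Type*} [Fintype ι] [AddCommMonoid M] (S : ι → Prop) (f : ι → M) :
    ∑ x : {x // S x}, f x.1 = ∑ x, if S x then f x else 0 := by
  rw [← Finset.sum_filter]
  exact (Finset.sum_subtype (Finset.univ.filter S) (p := S) (by simp) f).symm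

theorem mrank_add_le {ι : Type*} [Fintype ι] {k : Type*} [Field k] (A B : Matrix ι ι k) :
    (A + B).rank ≤ A.rank + B.rank := by
  unfold Matrix.rank
  rw [Matrix.mulVecLin_add]
  refine le_trans (Submodule.finrank_mono ?_) (Submodule.finrank_add_le_finrank_add_finrank _ _)
  rintro _ ⟨v, rfl⟩
  exact Submodule.add_mem_sup ⟨v, rfl⟩ ⟨v, rfl⟩

theorem exists_rows {ι κ : Type*} [Fintype ι] [Fintype κ] {k : Type*} [Field k]
    (r : ℕ) (A : Matrix ι κ k) (h : r ≤ A.rank) :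
    ∃ f : Fin r → ι, Function.Injective f ∧ LinearIndependent k (A.submatrix f id).row := by
  rw [A.rank_eq_finrank_span_row] at h
  obtain ⟨f, hf, -, hli⟩ := Submodule.exists_fun_fin_finrank_span_eq k (Set.range A.row)
  choose f' hf' using hf
  have hli' := hli.comp (Fin.castLE h) (Fin.castLE_injective h)
  have e : (A.submatrix (fun i => f' (Fin.castLE h i)) id).row = f ∘ Fin.castLE h := by
    funext i
    exact hf' (Fin.castLE h i)
  refine ⟨fun i => f' (Fin.castLE h i), ?_, by rw [e]; exact hli'⟩
  intro i j hij
  apply hli'.injective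
  simp only [Function.comp, ← hf']
  exact congrArg _ hij

theorem exists_minor {ι κ : Type*} [Fintype ι] [Fintype κ] {k : Type*} [Field k]
    (A : Matrix ι κ k) (r : ℕ) (h : r ≤ A.rank) :
    ∃ (f : Fin r → ι) (g : Fin r → κ), Function.Injective f ∧ Function.Injective g ∧
      (A.submatrix f g).det ≠ 0 := by
  obtain ⟨f, hf, hli⟩ := exists_rows r A h
  have hr : ((A.submatrix f id).transpose).rank = r := by
    rw [Matrix.rank_transpose, hli.rank_matrix, Fintype.card_fin]
  obtain ⟨g, hg, hli2⟩ := exists_rows r _ hr.ge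
  refine ⟨f, g, hf, hg, ?_⟩
  rw [Matrix.linearIndependent_rows_iff_isUnit, Matrix.isUnit_iff_isUnit_det,
    ← Matrix.det_transpose] at hli2
  exact hli2.ne_zero

theorem rank_bridge {ι : Type*} [Fintype ι] {k : Type*} [Field k]
    (A : Matrix ι ι k) (r : ℕ) :
    (∀ f g : Fin r → ι, Function.Injective f → Function.Injective g →
      (A.submatrix f g).det = 0) ↔ A.rank < r := by
  constructor
  · intro h
    by_contra hc
    obtain ⟨f, g, hf, hg, hd⟩ := exists_minor A r (not_lt.mp hc)
    exact hd (h f g hf hg)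
  · intro h f g hf hg
    by_contra hd
    have := Matrix.rank_of_det_ne_zero hd
    have h2 := Matrix.rank_submatrix_le A f g
    rw [this, Fintype.card_fin] at h2
    omega

/-- If `Q² = 0` and there is a kernel vector that is not in the image, the rank is small. -/
theorem rank_lt_of_ker {ι : Type*} [Fintype ι] {k : Type*} [Field k] (Q : Matrix ι ι k)
    (hQ : Q * Q = 0) (v : ι → k) (hv : Q.mulVec v = 0) (hni : ∀ w, Q.mulVec w ≠ v) :
    2 * Q.rank < Fintype.card ι := by
  have h1 : LinearMap.range Q.mulVecLin < LinearMap.ker Q.mulVecLin := by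
    refine lt_of_le_of_ne ?_ ?_
    · rintro _ ⟨w, rfl⟩
      simp [hQ]
    · intro he
      have : v ∈ LinearMap.ker Q.mulVecLin := by simpa using hv
      rw [← he] at this
      obtain ⟨w, hw⟩ := this
      exact hni w (by simpa using hw)
  have h2 := Submodule.finrank_lt_finrank_of_lt h1
  have h3 := LinearMap.finrank_range_add_finrank_ker Q.mulVecLin
  rw [Module.finrank_fintype_fun_eq_card] at h3
  unfold Matrix.rank
  omega

/-- If `Q` is bipartite for `S ⊔ Sᶜ` and `Q² = 0` then `rank Q ≤ |S|`. -/
theorem rank_le_of_bip {ι : Type*} [Fintype ι] {k : Type*} [Field k] (Q : Matrix ι ι k)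
    (hQ : Q * Q = 0) (S : ι → Prop)
    (hS : ∀ y z, ¬ S y → ¬ S z → Q y z = 0) (hS' : ∀ y z, S y → S z → Q y z = 0) :
    Q.rank ≤ (Finset.univ.filter S).card := by
  set R := Q.submatrix (Subtype.val : {x // S x} → ι) id with hR
  set C := Q.submatrix id (Subtype.val : {x // S x} → ι) with hC
  have hm : C * R = 0 := by
    ext y z
    have h1 : (C * R) y z = ∑ x ∈ Finset.univ.filter S, Q y x * Q x z := by
      rw [Finset.sum_filter, ← sum_sub S (fun x => Q y x * Q x z)]
      rfl
    rw [h1]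
    by_cases hy : S y
    · exact Finset.sum_eq_zero fun x hx => by
        rw [hS' y x hy (by simpa using hx), zero_mul]
    · have := congrFun (congrFun hQ y) z
      rw [Matrix.mul_apply] at this
      rw [Matrix.zero_apply] at this ⊢
      rw [← this, Finset.sum_filter]
      refine Finset.sum_congr rfl fun x _ => ?_
      by_cases hx : S x
      · simp [hx]
      · simp [hx, hS y x hy hx]
  have hdec : Q = (1 : Matrix ι ι k).submatrix id (Subtype.val : {x // S x} → ι) * R
      + C * (1 : Matrix ι ι k).submatrix (Subtype.val : {x // S x} → ι) id := by
    ext y z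
    have h1 : ((1 : Matrix ι ι k).submatrix id (Subtype.val : {x // S x} → ι) * R) y z
        = if S y then Q y z else 0 := by
      refine (sum_sub S (fun x => (1 : Matrix ι ι k) y x * Q x z)).trans ?_
      rw [Finset.sum_eq_single y]
      · simp
      · intro x _ hx
        simp [Matrix.one_apply_ne, hx, hx.symm]
      · simp
    have h2 : (C * (1 : Matrix ι ι k).submatrix (Subtype.val : {x // S x} → ι) id) y z
        = if S z then Q y z else 0 := by
      refine (sum_sub S (fun x => Q y x * (1 : Matrix ι ι k) x z)).trans ?_
      rw [Finset.sum_eq_single z]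
      · simp
      · intro x _ hx
        simp [Matrix.one_apply_ne, hx, hx.symm]
      · simp
    rw [Matrix.add_apply, h1, h2]
    by_cases hy : S y <;> by_cases hz : S z
    · simp [hS' y z hy hz]
    · simp [hy, hz]
    · simp [hy, hz]
    · simp [hS y z hy hz]
  have h1 := Matrix.rank_add_rank_le_card_of_mul_eq_zero hm
  have h2 := mrank_add_le ((1 : Matrix ι ι k).submatrix id (Subtype.val : {x // S x} → ι) * R)
    (C * (1 : Matrix ι ι k).submatrix (Subtype.val : {x // S x} → ι) id)
  rw [← hdec] at h2
  have h3 := Matrix.rank_mul_le_right ((1 : Matrix ι ι k).submatrix id (Subtype.val : {x // S x} → ι)) R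
  have h4 := Matrix.rank_mul_le_left C ((1 : Matrix ι ι k).submatrix (Subtype.val : {x // S x} → ι) id)
  have h5 : Fintype.card {x // S x} = (Finset.univ.filter S).card := by
    rw [Fintype.card_subtype]
  omega

theorem le_rank_of_inj {ι : Type*} [Fintype ι] {k : Type*} [Field k] (Q : Matrix ι ι k)
    (S : ι → Prop) (h : ∀ v : ι → k, (∀ x, ¬ S x → v x = 0) → Q.mulVec v = 0 → v = 0) :
    (Finset.univ.filter S).card ≤ Q.rank := by
  have h1 : (Q.submatrix id (Subtype.val : {x // S x} → ι)).rank = Fintype.card {x // S x} := by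
    have : LinearIndependent k (Q.submatrix id (Subtype.val : {x // S x} → ι)).col := by
      rw [← Matrix.mulVec_injective_iff]
      rw [← Matrix.coe_mulVecLin, ← LinearMap.ker_eq_bot, LinearMap.ker_eq_bot']
      intro m hm
      have := h (fun x => if hx : S x then m ⟨x, hx⟩ else 0) (fun x hx => by simp [hx]) (by
        funext y
        have := congrFun hm y
        simp only [Matrix.mulVecLin_apply, Matrix.mulVec, dotProduct, Matrix.submatrix_apply, id, Pi.zero_apply] at this ⊢
        rw [← this]
        refine Eq.trans ?_ ((sum_sub S (fun x => Q y x * (if hx : S x then m ⟨x, hx⟩ else 0))).symm.trans ?_)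
        · refine Finset.sum_congr rfl fun x _ => ?_
          by_cases hx : S x <;> simp [hx, this]
        · refine Finset.sum_congr rfl fun x _ => ?_
          simp [x.2])
      funext x
      have := congrFun this x.1
      simpa [x.2] using this
    have h2 := LinearIndependent.rank_matrix (M := (Q.submatrix id (Subtype.val : {x // S x} → ι)).transpose) this
    rwa [Matrix.rank_transpose] at h2
  rw [← Fintype.card_subtype, ← h1]
  exact Matrix.rank_submatrix_le Q id _

theorem rank_le_of_bip' {ι : Type*} [Fintype ι] {k : Type*} [Field k] (Q : Matrix ι ι k)
    (hQ : Q * Q = 0) (S : ι → Prop) [DecidablePred S]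
    (hS : ∀ y z, ¬ S y → ¬ S z → Q y z = 0) (hS' : ∀ y z, S y → S z → Q y z = 0) :
    Q.rank ≤ (Finset.univ.filter S).card := by
  convert rank_le_of_bip Q hQ S hS hS'

theorem le_rank_of_inj' {ι : Type*} [Fintype ι] {k : Type*} [Field k] (Q : Matrix ι ι k)
    (S : ι → Prop) [DecidablePred S]
    (h : ∀ v : ι → k, (∀ x, ¬ S x → v x = 0) → Q.mulVec v = 0 → v = 0) :
    (Finset.univ.filter S).card ≤ Q.rank := by
  convert le_rank_of_inj Q S h


/-! ### Cyclic arithmetic in `Fin n` -/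

theorem fin_one_ne {n : ℕ} [NeZero n] (hn : 2 ≤ n) : (1 : Fin n) ≠ 0 := by
  intro h
  have := congrArg Fin.val h
  rw [Fin.val_one', Fin.val_zero, Nat.mod_eq_of_lt (by omega)] at this
  omega

theorem fin_two_ne {n : ℕ} [NeZero n] (hn : 3 ≤ n) : (1 : Fin n) + 1 ≠ 0 := by
  intro h
  have := congrArg Fin.val h
  rw [Fin.val_add, Fin.val_one', Fin.val_zero, Nat.mod_eq_of_lt (a := 1) (by omega),
    Nat.mod_eq_of_lt (by omega)] at this
  omega

theorem fin_three_ne {n : ℕ} [NeZero n] (hn : 4 ≤ n) : (1 : Fin n) + 1 + 1 ≠ 0 := by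
  intro h
  have := congrArg Fin.val h
  rw [Fin.val_add, Fin.val_add, Fin.val_one', Fin.val_zero, Nat.mod_eq_of_lt (a := 1) (by omega),
    Nat.mod_eq_of_lt (a := 1 + 1) (by omega), Nat.mod_eq_of_lt (by omega)] at this
  omega

theorem fin_succ_ne {n : ℕ} [NeZero n] (hn : 2 ≤ n) (i : Fin n) : i + 1 ≠ i := by
  simpa using fin_one_ne hn

theorem fin_pred_ne {n : ℕ} [NeZero n] (hn : 2 ≤ n) (i : Fin n) : i - 1 ≠ i := by
  simpa using fin_one_ne hn

theorem fin_pred_ne_succ {n : ℕ} [NeZero n] (hn : 3 ≤ n) (i : Fin n) : i - 1 ≠ i + 1 := by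
  intro h
  apply fin_two_ne hn
  have h2 : i = i + 1 + 1 := by rw [← h]; abel
  have h3 : i + (1 + 1) = i + 0 := by rw [← add_assoc, ← h2, add_zero]
  exact add_left_cancel h3

/-! ### States and the matrix `QM` -/

abbrev St (n : ℕ) := Fin n → Bool

def fl {n : ℕ} (i : Fin n) (x : St n) : St n := Function.update x i (!x i)

def src {n : ℕ} [NeZero n] (i : Fin n) (x : St n) : Prop := x (i - 1) = x i ∧ x (i + 1) = x i

def sg {n : ℕ} (k : Type*) [Field k] (i : Fin n) (x : St n) : k :=
  (-1) ^ (Finset.univ.filter fun j => j < i ∧ x j = true).card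

def qq {n : ℕ} {k : Type*} [Field k] (a c : Fin n → k) (i : Fin n) (x : St n) : k :=
  sg k i x * (if x i = true then c i else a i)

def QM {n : ℕ} [NeZero n] {k : Type*} [Field k] (a c : Fin n → k) : Matrix (St n) (St n) k :=
  fun y z => ∑ i, if z = fl i y ∧ src i z then qq a c i z else 0

def stEquiv (n : ℕ) : Finset (Fin n) ≃ St n where
  toFun σ := fun i => decide (i ∈ σ)
  invFun x := Finset.univ.filter fun i => x i = true
  left_inv σ := by ext i; simp
  right_inv x := by funext i; simp

def cc {n : ℕ} (k : Type*) [Field k] (X : Finset (Finset (Fin n))) (i : Fin n) : k :=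
  if {i} ∈ X then 0 else 1

section edges
variable {n : ℕ} [NeZero n] {X : Finset (Finset (Fin n))}

theorem clique_mem (hcyc : GcdGraphIsCycle n X) {τ : Finset (Fin n)} (hτ : τ ∈ X) {i j : Fin n}
    (hi : i ∈ τ) (hj : j ∈ τ) : j = i ∨ j = i + 1 ∨ j = i - 1 := by
  by_cases h : j = i
  · exact Or.inl h
  · rcases (hcyc i j).1 ⟨fun e => h e.symm, τ, hτ, hi, hj⟩ with h1 | h1
    · exact Or.inr (Or.inl h1)
    · right; right; rw [h1]; abel

theorem diffEdge_iff (hn : 4 ≤ n) (hcyc : GcdGraphIsCycle n X) (σ : Finset (Fin n)) (i : Fin n) :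
    DiffEdge X σ i ↔ i ∉ σ ∧ {i} ∉ X ∧ i - 1 ∈ σ ∧ i + 1 ∈ σ := by
  have hnot : ∀ τ ∈ X, i - 1 ∈ τ → i + 1 ∈ τ → False := by
    intro τ hτ h1 h2
    rcases (hcyc (i - 1) (i + 1)).1 ⟨fin_pred_ne_succ (by omega) i, τ, hτ, h1, h2⟩ with h | h
    · apply fin_one_ne (n := n) (by omega)
      have : i + 1 = i + 0 := by rw [h]; abel
      exact add_left_cancel this
    · apply fin_three_ne hn
      have : i - 1 + (1 + 1 + 1) = i - 1 + 0 := by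
        rw [add_zero]; conv_rhs => rw [h]
        abel
      exact add_left_cancel this
  constructor
  · rintro ⟨h1, h2⟩
    refine ⟨h1, fun h => ?_, ?_, ?_⟩
    · obtain ⟨j, hj⟩ := h2 _ h (Finset.mem_singleton_self i)
      simp only [Finset.mem_inter, Finset.mem_singleton] at hj
      exact h1 (hj.1 ▸ hj.2)
    · obtain ⟨-, τ, hτ, hi, hj⟩ := (hcyc i (i - 1)).2 (Or.inr (by abel))
      obtain ⟨j, hj'⟩ := h2 τ hτ hi
      rw [Finset.mem_inter] at hj'
      rcases clique_mem hcyc hτ hi hj'.1 with rfl | rfl | rfl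
      · exact absurd hj'.2 h1
      · exact (hnot τ hτ hj hj'.1).elim
      · exact hj'.2
    · obtain ⟨-, τ, hτ, hi, hj⟩ := (hcyc i (i + 1)).2 (Or.inl rfl)
      obtain ⟨j, hj'⟩ := h2 τ hτ hi
      rw [Finset.mem_inter] at hj'
      rcases clique_mem hcyc hτ hi hj'.1 with rfl | rfl | rfl
      · exact absurd hj'.2 h1
      · exact hj'.2
      · exact (hnot τ hτ hj'.1 hj).elim
  · rintro ⟨h1, h2, h3, h4⟩
    refine ⟨h1, fun τ hτ hi => ?_⟩
    by_cases h : τ = {i}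
    · exact absurd (h ▸ hτ) h2
    · obtain ⟨j, hj, hji⟩ : ∃ j ∈ τ, j ≠ i := by
        by_contra hc
        push Not at hc
        exact h (Finset.eq_singleton_iff_unique_mem.2 ⟨hi, hc⟩)
      refine ⟨j, Finset.mem_inter.2 ⟨hj, ?_⟩⟩
      rcases clique_mem hcyc hτ hi hj with rfl | rfl | rfl
      · exact absurd rfl hji
      · exact h4
      · exact h3

theorem homEdge_iff (hcyc : GcdGraphIsCycle n X) (σ : Finset (Fin n)) (i : Fin n) :
    HomEdge X σ i ↔ i ∉ σ ∧ i - 1 ∉ σ ∧ i + 1 ∉ σ := by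
  unfold HomEdge Nbhd
  simp only [Finset.mem_filter, Finset.mem_univ, true_and, not_exists, not_and]
  refine and_congr_right fun _ => ⟨fun h => ⟨fun h1 => h _ h1 ?_, fun h1 => h _ h1 ?_⟩, ?_⟩
  · exact (hcyc _ _).2 (Or.inl (by abel))
  · exact (hcyc _ _).2 (Or.inr rfl)
  · rintro ⟨h1, h2⟩ j hj hadj
    rcases (hcyc _ _).1 hadj with h | h
    · apply h1
      have : i - 1 = j := by rw [h]; abel
      rwa [this]
    · exact h2 (h ▸ hj)

theorem taylor_eq {k : Type*} [Field k] (hn : 4 ≤ n) (hcyc : GcdGraphIsCycle n X) (a : Fin n → k) :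
    taylorMatrixAt X a = (QM a (cc k X)).submatrix (stEquiv n) (stEquiv n) := by
  ext r c
  simp only [Matrix.submatrix_apply]
  unfold taylorMatrixAt QM
  rw [← Finset.sum_add_distrib]
  refine Finset.sum_congr rfl fun i _ => ?_
  have hp := fin_pred_ne (n := n) (by omega) i
  have hs := fin_succ_ne (n := n) (by omega) i
  by_cases hi : i ∈ r
  · rw [if_neg (fun h => h.2.1 hi), zero_add]
    have e1 : (r = insert i c ∧ HomEdge X c i) ↔
        (stEquiv n c = fl i (stEquiv n r) ∧ src i (stEquiv n c)) := by
      rw [homEdge_iff hcyc]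
      constructor
      · rintro ⟨rfl, h1, h2, h3⟩
        refine ⟨?_, ?_⟩
        · funext j
          by_cases hj : j = i
          · subst hj; simp [stEquiv, fl, h1]
          · simp [stEquiv, fl, hj]
        · simp [src, stEquiv, h1, h2, h3]
      · rintro ⟨h1, h2⟩
        have hc : i ∉ c := by
          have := congrFun h1 i
          simpa [stEquiv, fl, hi] using this
        refine ⟨?_, hc, ?_⟩
        · ext j
          by_cases hj : j = i
          · subst hj; simp [hi]
          · have := congrFun h1 j
            simp [stEquiv, fl, hj] at this
            simp [hj, this]
        · simpa [src, stEquiv, hc] using h2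
    by_cases h : r = insert i c ∧ HomEdge X c i
    · rw [if_pos h, if_pos (e1.1 h)]
      have hc : i ∉ c := h.2.1
      simp [qq, stEquiv, hc, sg, edgeSign, Finset.filter_and, Finset.filter_mem_eq_inter,
        Finset.inter_comm]
      left
      congr 2
      ext j; simp [and_comm]
    · rw [if_neg h, if_neg (fun h' => h (e1.2 h'))]
  · rw [if_neg (c := r = insert i c ∧ _) (fun h => hi (by rw [h.1]; simp)), add_zero]
    have e1 : (c = insert i r ∧ i - 1 ∈ r ∧ i + 1 ∈ r) ↔
        (stEquiv n c = fl i (stEquiv n r) ∧ src i (stEquiv n c)) := by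
      constructor
      · rintro ⟨rfl, h2, h3⟩
        refine ⟨?_, ?_⟩
        · funext j
          by_cases hj : j = i
          · subst hj; simp [stEquiv, fl, hi]
          · simp [stEquiv, fl, hj]
        · simp [src, stEquiv, h2, h3]
      · rintro ⟨h1, h2⟩
        have hc : i ∈ c := by
          have := congrFun h1 i
          simpa [stEquiv, fl, hi] using this
        have hci : c = insert i r := by
          ext j
          by_cases hj : j = i
          · subst hj; simp [hc]
          · have := congrFun h1 j
            simp [stEquiv, fl, hj] at this
            simp [hj, this]
        refine ⟨hci, ?_⟩
        subst hci
        simpa [src, stEquiv, hp, hs] using h2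
    rw [diffEdge_iff hn hcyc]
    by_cases h : c = insert i r ∧ i - 1 ∈ r ∧ i + 1 ∈ r
    · rw [if_pos (c := _ ∧ src _ _) (e1.1 h)]
      have hc : i ∈ c := by rw [h.1]; simp
      have hsg : sg k i (stEquiv n c) = ((edgeSign r i : ℤ) : k) := by
        simp only [sg, edgeSign, stEquiv]
        push_cast
        congr 2
        ext j
        rw [h.1]
        simp
        constructor
        · rintro ⟨h1, rfl | h2⟩
          · exact absurd h1 (lt_irrefl _)
          · exact ⟨h2, h1⟩
        · rintro ⟨h1, h2⟩
          exact ⟨h2, Or.inr h1⟩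
      have hx : (stEquiv n c) i = true := by simp [stEquiv, hc]
      rw [qq, hsg, hx, if_pos rfl, cc]
      by_cases hX : {i} ∈ X
      · rw [if_pos hX, if_neg (by tauto), mul_zero]
      · rw [if_neg hX, if_pos (by tauto), mul_one]
    · rw [if_neg (by tauto), if_neg (fun h' => h (e1.2 h'))]

theorem mem_variety_iff {k : Type*} [Field k] (hn : 4 ≤ n) (hcyc : GcdGraphIsCycle n X)
    (a : Fin n → k) :
    a ∈ supportVariety k X ↔ (QM a (cc k X)).rank < 2 ^ (n - 1) := by
  rw [supportVariety, Set.mem_ofPred_eq, rank_bridge, taylor_eq hn hcyc, Matrix.rank_submatrix]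

end edges


/-! ### The case `n = 3` -/

theorem fin3_aux1 : ∀ i j : Fin 3, i ≠ j → (j = i + 1 ∨ i = j + 1) := by decide

theorem fin3_aux2 : ∀ (r : Finset (Fin 3)) (i : Fin 3), i ∉ r → insert i r ≠ Finset.univ →
    ∃ m, m ≠ i ∧ r ⊆ {m} := by decide

theorem variety_three {k : Type*} [Field k] (X : Finset (Finset (Fin 3)))
    (hX : IsGenPattern 3 X) (hcyc : GcdGraphIsCycle 3 X) : supportVariety k X = Set.univ := by
  rw [Set.eq_univ_iff_forall]
  intro a f g hf hg
  obtain ⟨t, ht⟩ : ∃ t, ¬ (g t = ∅ ∨ g t = Finset.univ) := by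
    by_contra hc
    push Not at hc
    have h1 : Finset.univ.image g ⊆ {∅, Finset.univ} := by
      intro s hs
      simp only [Finset.mem_image, Finset.mem_univ, true_and] at hs
      obtain ⟨t, rfl⟩ := hs
      simpa using hc t
    have h2 := Finset.card_le_card h1
    rw [Finset.card_image_of_injective _ hg, Finset.card_univ, Fintype.card_fin] at h2
    have h3 := Finset.card_le_two (a := (∅ : Finset (Fin 3))) (b := Finset.univ)
    norm_num at h2
    omega
  push Not at ht
  apply Matrix.det_eq_zero_of_column_eq_zero t
  intro s
  rw [Matrix.submatrix_apply]
  unfold taylorMatrixAt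
  rw [Finset.sum_eq_zero, Finset.sum_eq_zero, add_zero]
  · intro i _
    rw [if_neg]
    rintro ⟨h1, h2, h3⟩
    obtain ⟨j, hj⟩ := ht.1
    apply h3
    simp only [Nbhd, Finset.mem_filter, Finset.mem_univ, true_and]
    refine ⟨j, hj, (hcyc _ _).2 (fin3_aux1 _ _ ?_)⟩
    rintro rfl
    exact h2 hj
  · intro i _
    rw [if_neg]
    rintro ⟨h1, h2, h3⟩
    obtain ⟨m, hm, hr⟩ := fin3_aux2 (f s) i h2 (h1 ▸ ht.2)
    obtain ⟨τ, hτ, hi, hmτ⟩ := hX.2 i m hm.symm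
    obtain ⟨j, hj⟩ := h3 τ hτ hi
    rw [Finset.mem_inter] at hj
    have := hr hj.2
    rw [Finset.mem_singleton] at this
    exact hmτ (this ▸ hj.1)


/-! ### Basic properties of `QM` -/

section basicQ
variable {n : ℕ} {k : Type*} [Field k]

@[simp] theorem fl_same (i : Fin n) (x : St n) : fl i x i = !x i := by simp [fl]

theorem fl_ne {i j : Fin n} (h : j ≠ i) (x : St n) : fl i x j = x j := by simp [fl, h]

@[simp] theorem fl_fl (i : Fin n) (x : St n) : fl i (fl i x) = x := by
  funext j
  by_cases h : j = i
  · subst h; simp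
  · simp [fl_ne h]

theorem fl_comm (i j : Fin n) (x : St n) : fl i (fl j x) = fl j (fl i x) := by
  by_cases hij : i = j
  · rw [hij]
  funext t
  by_cases h : t = i
  · subst h; simp [fl_ne hij]
  · by_cases h' : t = j
    · subst h'; simp [fl_ne h]
    · simp [fl_ne h, fl_ne h']

theorem sg_prod (i : Fin n) (x : St n) :
    sg k i x = ∏ j, if j < i ∧ x j = true then (-1 : k) else 1 := by
  rw [Finset.prod_ite]; simp [sg]

theorem sg_fl (i j : Fin n) (x : St n) :
    sg k i (fl j x) = if j < i then - sg k i x else sg k i x := by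
  rw [sg_prod, sg_prod, ← Finset.mul_prod_erase _ _ (Finset.mem_univ j),
    ← Finset.mul_prod_erase (a := j) _ (fun t => if t < i ∧ x t = true then (-1 : k) else 1)
      (Finset.mem_univ j)]
  have : ∏ t ∈ Finset.univ.erase j, (if t < i ∧ fl j x t = true then (-1 : k) else 1)
      = ∏ t ∈ Finset.univ.erase j, (if t < i ∧ x t = true then (-1 : k) else 1) := by
    refine Finset.prod_congr rfl fun t ht => ?_
    rw [fl_ne (Finset.ne_of_mem_erase ht)]
  rw [this]
  by_cases h : j < i <;> cases hx : x j <;> simp [h, hx]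

theorem qq_fl (a c : Fin n → k) {i j : Fin n} (h : i ≠ j) (x : St n) :
    qq a c i (fl j x) = if j < i then - qq a c i x else qq a c i x := by
  unfold qq
  rw [sg_fl, fl_ne h]
  split_ifs <;> ring

theorem sg_sq (i : Fin n) (x : St n) : sg k i x * sg k i x = 1 := by
  unfold sg
  rw [← pow_add, ← two_mul, pow_mul]; simp

def cpl {n : ℕ} (x : St n) : St n := fun i => !x i

theorem sg_compl (i : Fin n) (x : St n) : sg k i x * sg k i (cpl x) = (-1) ^ i.val := by
  rw [sg_prod, sg_prod, ← Finset.prod_mul_distrib]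
  have : ∀ j : Fin n, ((if j < i ∧ x j = true then (-1 : k) else 1) *
      (if j < i ∧ cpl x j = true then (-1 : k) else 1)) = if j < i then -1 else 1 := by
    intro j
    by_cases h : j < i <;> cases hx : x j <;> simp [h, hx, cpl]
  simp only [this]
  rw [Finset.prod_ite]
  simp only [Finset.prod_const, one_pow, mul_one]
  congr 1
  have h2 : (Finset.univ.filter fun j => j < i) = Finset.Iio i := by ext; simp
  rw [h2, Fin.card_Iio]

theorem qq_compl (a c : Fin n → k) (i : Fin n) (x : St n) :
    qq a c i x * qq a c i (cpl x) = (-1) ^ i.val * (a i * c i) := by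
  rw [← sg_compl i x]
  unfold qq
  cases hx : x i <;> simp [cpl, hx] <;> ring

variable [NeZero n]

theorem QM_mulVec (a c : Fin n → k) (v : St n → k) (y : St n) :
    (QM a c).mulVec v y = ∑ i, if src i (fl i y) then qq a c i (fl i y) * v (fl i y) else 0 := by
  simp only [Matrix.mulVec, dotProduct, QM, Finset.sum_mul]
  rw [Finset.sum_comm]
  refine Finset.sum_congr rfl fun i _ => ?_
  rw [Finset.sum_eq_single (fl i y)]
  · simp
  · intro z _ hz
    simp [hz]
  · simp

theorem src_fl_not (i : Fin n) (hn : 3 ≤ n) (x : St n) (h : src i (fl i x)) : ¬ src i x := by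
  intro h2
  have h1 := h.1
  rw [fl_same, fl_ne (fin_pred_ne (by omega) i), h2.1] at h1
  cases hx : x i <;> simp [hx] at h1

theorem QM_sq (hn : 3 ≤ n) (a c : Fin n → k) : QM a c * QM a c = 0 := by
  apply Matrix.ext_of_mulVec_single
  intro z
  rw [← Matrix.mulVec_mulVec]
  generalize (Pi.single z 1 : St n → k) = v
  funext y
  rw [QM_mulVec, Matrix.zero_mulVec, Pi.zero_apply]
  simp only [QM_mulVec]
  set F : Fin n × Fin n → k := fun p =>
    if src p.1 (fl p.1 y) ∧ src p.2 (fl p.2 (fl p.1 y)) then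
      qq a c p.1 (fl p.1 y) * (qq a c p.2 (fl p.2 (fl p.1 y)) * v (fl p.2 (fl p.1 y))) else 0
    with hF
  have hsum : ∀ i : Fin n, (if src i (fl i y) then qq a c i (fl i y) *
      ∑ j, (if src j (fl j (fl i y)) then qq a c j (fl j (fl i y)) * v (fl j (fl i y)) else 0)
      else 0) = ∑ j, F (i, j) := by
    intro i
    by_cases h : src i (fl i y)
    · rw [if_pos h, Finset.mul_sum]
      refine Finset.sum_congr rfl fun j _ => ?_
      by_cases h2 : src j (fl j (fl i y)) <;> simp [hF, h, h2]
    · simp [hF, h]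
  simp only [hsum]
  rw [← Fintype.sum_prod_type (f := F)]
  have hii : ∀ i, F (i, i) = 0 := by
    intro i
    simp only [hF, fl_fl]
    rw [if_neg]
    rintro ⟨h1, h2⟩
    exact src_fl_not i hn y h1 h2
  have hadj : ∀ i, F (i, i + 1) = 0 := by
    intro i
    simp only [hF]
    rw [if_neg]
    rintro ⟨h1, h2⟩
    have h3 := h1.2
    have h4 := h2.1
    rw [fl_same, fl_ne (fin_pred_ne (by omega) _), add_sub_cancel_right] at h4
    rw [h3] at h4
    cases hx : fl i y i <;> simp [hx] at h4
  have hadj' : ∀ i, F (i + 1, i) = 0 := by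
    intro i
    simp only [hF]
    rw [if_neg]
    rintro ⟨h1, h2⟩
    have h3 := h1.1
    have h4 := h2.2
    rw [add_sub_cancel_right] at h3
    rw [fl_same, fl_ne (fin_succ_ne (by omega) _)] at h4
    rw [h3] at h4
    cases hx : fl (i + 1) y (i + 1) <;> simp [hx] at h4
  have hanti : ∀ i j, F (i, j) + F (j, i) = 0 := by
    intro i j
    by_cases h1 : i = j
    · subst h1; rw [hii, add_zero]
    by_cases h2 : j = i + 1
    · subst h2; rw [hadj, hadj', add_zero]
    by_cases h3 : i = j + 1
    · subst h3; rw [hadj, hadj', add_zero]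
    have e1 : ∀ {i j : Fin n} (z : St n), i ≠ j → j ≠ i + 1 → i ≠ j + 1 →
        (src i (fl j z) ↔ src i z) := by
      intro i j z h1 h2 h3
      unfold src
      rw [fl_ne h1, fl_ne (Ne.symm h2), fl_ne]
      rintro h
      apply h3; rw [← h]; abel
    simp only [hF]
    rw [fl_comm j i, e1 (i := j) (j := i), fl_comm i j, e1 (i := i) (j := j)]
    · by_cases hi : src i (fl i y) <;> by_cases hj : src j (fl j y) <;> simp [hi, hj]
      rw [qq_fl a c h1 (fl i y), fl_comm j i, qq_fl a c (Ne.symm h1) (fl j y)]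
      rcases lt_or_gt_of_ne h1 with h | h
      · simp [h, h.not_gt]; ring
      · simp [h, h.not_gt]; ring
    all_goals first | assumption | exact Ne.symm h1
  refine Finset.sum_involution (fun p _ => (p.2, p.1)) ?_ ?_ ?_ ?_
  · intro p _; exact hanti _ _
  · rintro ⟨i, j⟩ _ hne he
    have : i = j := by simpa using (congrArg Prod.fst he).symm
    subst this
    exact hne (hii _)
  · intro p _; simp
  · intro p _; simp

end basicQ


/-! ### Sites indexed by natural numbers -/

def nn (n : ℕ) [NeZero n] (t : ℕ) : Fin n := Fin.ofNat n t

section sites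
variable {n : ℕ} [NeZero n]

theorem nn_val (t : ℕ) : (nn n t).val = t % n := rfl

theorem nn_of_lt {t : ℕ} (h : t < n) : (nn n t).val = t := by
  rw [nn_val, Nat.mod_eq_of_lt h]

theorem nn_eq_iff (s t : ℕ) : nn n s = nn n t ↔ s % n = t % n := by
  rw [Fin.ext_iff, nn_val, nn_val]

theorem nn_eq_of_lt {s t : ℕ} (hs : s < n) (ht : t < n) : nn n s = nn n t ↔ s = t := by
  rw [nn_eq_iff, Nat.mod_eq_of_lt hs, Nat.mod_eq_of_lt ht]

@[simp] theorem nn_coe (i : Fin n) : nn n i.val = i := by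
  rw [Fin.ext_iff, nn_val, Nat.mod_eq_of_lt i.2]

theorem nn_add (s t : ℕ) : nn n s + nn n t = nn n (s + t) := by
  rw [Fin.ext_iff, Fin.val_add, nn_val, nn_val, nn_val, ← Nat.add_mod]

theorem nn_one : nn n 1 = 1 := by
  rw [Fin.ext_iff, nn_val, Fin.val_one']

theorem nn_zero : nn n 0 = 0 := by
  rw [Fin.ext_iff, nn_val, Fin.val_zero]; simp

theorem nn_succ (t : ℕ) : nn n t + 1 = nn n (t + 1) := by
  rw [← nn_one, nn_add]

theorem nn_pred (t : ℕ) : nn n (t + 1) - 1 = nn n t := by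
  rw [← nn_succ]; abel

theorem nn_add_self (t : ℕ) : nn n (t + n) = nn n t := by
  rw [nn_eq_iff]; simp

theorem nn_self : nn n n = 0 := by
  rw [← nn_zero, nn_eq_iff]; simp

theorem sum_nn {M : Type*} [AddCommMonoid M] (f : Fin n → M) :
    ∑ i, f i = ∑ t ∈ Finset.range n, f (nn n t) := by
  rw [Finset.sum_range]
  simp

theorem prod_nn {M : Type*} [CommMonoid M] (f : Fin n → M) :
    ∏ i, f i = ∏ t ∈ Finset.range n, f (nn n t) := by
  rw [Finset.prod_range]
  simp

/-! ### The grading -/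

def bd (x : St n) (j : Fin n) : ℕ := if x j = x (j + 1) then 0 else 1

def ww (x : St n) : ℕ := ∑ j, bd x j

theorem ww_fl (hn : 3 ≤ n) (i : Fin n) (x : St n) (h : src i x) : ww (fl i x) = ww x + 2 := by
  unfold ww
  have hpi : i - 1 ∈ (Finset.univ.erase i : Finset (Fin n)) := by
    simp only [Finset.mem_erase, Finset.mem_univ, and_true]
    exact fin_pred_ne (by omega) i
  rw [← Finset.add_sum_erase _ _ (Finset.mem_univ i), ← Finset.add_sum_erase _ _ hpi,
    ← Finset.add_sum_erase _ (bd x) (Finset.mem_univ i), ← Finset.add_sum_erase _ (bd x) hpi]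
  have hrest : ∑ j ∈ (Finset.univ.erase i).erase (i - 1), bd (fl i x) j
      = ∑ j ∈ (Finset.univ.erase i).erase (i - 1), bd x j := by
    refine Finset.sum_congr rfl fun j hj => ?_
    simp only [Finset.mem_erase, Finset.mem_univ, and_true] at hj
    unfold bd
    rw [fl_ne hj.2, fl_ne]
    intro h
    apply hj.1; rw [← h]; abel
  rw [hrest]
  obtain ⟨h1, h2⟩ := h
  have e1 : bd (fl i x) i = 1 := by
    unfold bd
    rw [fl_same, fl_ne (fin_succ_ne (by omega) i), h2]
    cases x i <;> simp
  have e2 : bd (fl i x) (i - 1) = 1 := by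
    unfold bd
    rw [sub_add_cancel, fl_same, fl_ne (fin_pred_ne (by omega) i), h1]
    cases x i <;> simp
  have e3 : bd x i = 0 := by simp [bd, h2]
  have e4 : bd x (i - 1) = 0 := by simp [bd, h1]
  rw [e1, e2, e3, e4]; omega

def sgw (x : St n) : ℤ := (-1) ^ (ww x / 2)

theorem sgw_fl (hn : 3 ≤ n) (i : Fin n) (x : St n) (h : src i x) : sgw (fl i x) = - sgw x := by
  unfold sgw
  rw [ww_fl hn i x h, show (ww x + 2) / 2 = ww x / 2 + 1 by omega, pow_succ]
  ring

theorem sgw_fl' (hn : 3 ≤ n) (i : Fin n) (x : St n) (h : x (i - 1) = x (i + 1)) :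
    sgw (fl i x) = - sgw x := by
  by_cases h2 : x i = x (i + 1)
  · exact sgw_fl hn i x ⟨by rw [h, h2], h2.symm⟩
  · have : src i (fl i x) := by
      unfold src
      rw [fl_same, fl_ne (fin_pred_ne (by omega) i), fl_ne (fin_succ_ne (by omega) i), h]
      cases hx : x i <;> cases hy : x (i + 1) <;> simp_all
    have := sgw_fl hn i _ this
    rw [fl_fl] at this
    rw [this, neg_neg]

theorem sgw_cases (x : St n) : sgw x = 1 ∨ sgw x = -1 := neg_one_pow_eq_or ℤ _

/-- active odd sites -/
def actv (x : St n) (t : ℕ) : Prop :=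
  t % 2 = 1 ∧ t + 1 < n ∧ x (nn n (t - 1)) = x (nn n (t + 1))

theorem actv_fl (x : St n) (s t : ℕ) (ht : t % 2 = 1) (htn : t < n) :
    actv (fl (nn n t) x) s ↔ actv x s := by
  unfold actv
  refine and_congr_right fun h1 => and_congr_right fun h2 => ?_
  rw [fl_ne, fl_ne]
  · rw [Ne, nn_eq_of_lt (by omega) (by omega)]; omega
  · rw [Ne, nn_eq_of_lt (by omega) (by omega)]; omega

theorem sum_sgw_eq (hn : 3 ≤ n) :
    ∑ x : St n, sgw x = ∑ x ∈ Finset.univ.filter (fun x : St n => ¬ ∃ t, actv x t), sgw x := by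
  rw [← Finset.sum_filter_add_sum_filter_not Finset.univ (fun x : St n => ∃ t, actv x t)]
  convert zero_add _
  have hne : ∀ x : St n, x ∈ Finset.univ.filter (fun x : St n => ∃ t, actv x t) → ∃ t, actv x t :=
    fun x hx => by simpa using hx
  have key : ∀ (x : St n) (h : ∃ t, actv x t), (∀ s, actv (fl (nn n (Nat.find h)) x) s ↔ actv x s)
      ∧ sgw (fl (nn n (Nat.find h)) x) = - sgw x := by
    intro x h
    have h1 := Nat.find_spec h
    refine ⟨fun s => actv_fl x s _ h1.1 (by have := h1.2.1; omega), sgw_fl' hn _ _ ?_⟩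
    have := h1.2.2
    obtain ⟨u, hu⟩ : ∃ u, Nat.find h = u + 1 := ⟨Nat.find h - 1, by have := h1.1; omega⟩
    rw [hu] at this ⊢
    rw [nn_pred, nn_succ]
    simpa using this
  refine Finset.sum_involution (fun x hx => fl (nn n (Nat.find (hne x hx))) x) ?_ ?_ ?_ ?_
  · intro x hx
    rw [(key x (hne x hx)).2]; ring
  · intro x hx _ he
    have := congrFun he (nn n (Nat.find (hne x hx)))
    rw [fl_same] at this
    cases hx : x (nn n (Nat.find (hne x hx))) <;> simp [hx] at this
  · intro x hx
    simp only [Finset.mem_filter, Finset.mem_univ, true_and]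
    simp only [(key x (hne x hx)).1]
    exact hne x hx
  · intro x hx
    have : ∀ (y : St n) (hy : ∃ t, actv y t), (∀ s, actv y s ↔ actv x s) →
        Nat.find hy = Nat.find (hne x hx) := by
      intro y hy hs
      apply le_antisymm
      · exact Nat.find_min' _ ((hs _).2 (Nat.find_spec (hne x hx)))
      · exact Nat.find_min' _ ((hs _).1 (Nat.find_spec hy))
    rw [this _ _ (key x (hne x hx)).1, fl_fl]

theorem noact_even {x : St n} (hx : ¬ ∃ t, actv x t) (s : ℕ) (hs : 2 * s < n) :
    x (nn n (2 * s)) = xor (x 0) (decide (s % 2 = 1)) := by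
  induction s with
  | zero => simp [nn_zero]
  | succ s ih =>
    have h1 := ih (by omega)
    have h2 : ¬ actv x (2 * s + 1) := fun h => hx ⟨_, h⟩
    unfold actv at h2
    have h3 : x (nn n (2 * s)) ≠ x (nn n (2 * (s + 1))) := by
      intro h
      exact h2 ⟨by omega, by omega, h⟩
    rw [h1] at h3
    rcases Nat.mod_two_eq_zero_or_one s with h | h
    · have h' : (s + 1) % 2 = 1 := by omega
      simp only [h, h'] at h3 ⊢
      cases hx0 : x 0 <;> cases hx1 : x (nn n (2 * (s + 1))) <;> simp_all
    · have h' : (s + 1) % 2 = 0 := by omega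
      simp only [h, h'] at h3 ⊢
      cases hx0 : x 0 <;> cases hx1 : x (nn n (2 * (s + 1))) <;> simp_all

theorem ww_range (x : St n) : ww x = ∑ t ∈ Finset.range n, bd x (nn n t) := sum_nn _

theorem sum_range_two_mul' (f : ℕ → ℕ) (m : ℕ) :
    ∑ t ∈ Finset.range (2 * m), f t = ∑ s ∈ Finset.range m, (f (2 * s) + f (2 * s + 1)) := by
  induction m with
  | zero => simp
  | succ m ih =>
    rw [show 2 * (m + 1) = 2 * m + 1 + 1 by ring, Finset.sum_range_succ, Finset.sum_range_succ, ih,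
      Finset.sum_range_succ]
    ring

theorem bd_pair (x : St n) (s : ℕ) (h : x (nn n (2 * s)) ≠ x (nn n (2 * s + 2))) :
    bd x (nn n (2 * s)) + bd x (nn n (2 * s + 1)) = 1 := by
  unfold bd
  rw [nn_succ, nn_succ]
  cases h1 : x (nn n (2 * s)) <;> cases h2 : x (nn n (2 * s + 1)) <;>
    cases h3 : x (nn n (2 * s + 1 + 1)) <;> simp_all

theorem noact_ne {x : St n} (hx : ¬ ∃ t, actv x t) (s : ℕ) (hs : 2 * s + 2 < n) :
    x (nn n (2 * s)) ≠ x (nn n (2 * s + 2)) := by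
  intro h
  exact hx ⟨2 * s + 1, by omega, by omega, h⟩

theorem ww_noact (hn : 3 ≤ n) (h4 : n % 4 ≠ 2) {x : St n} (hx : ¬ ∃ t, actv x t) :
    ww x = n / 2 + (if n % 2 = 0 then 0 else (n / 2) % 2) := by
  rw [ww_range]
  rcases Nat.even_or_odd' n with ⟨m, hm | hm⟩
  · have : ∑ t ∈ Finset.range n, bd x (nn n t) = ∑ t ∈ Finset.range (2 * m), bd x (nn n t) :=
      Finset.sum_congr (congrArg Finset.range hm) fun _ _ => rfl
    rw [this, sum_range_two_mul', Finset.sum_congr rfl (g := fun _ => 1)]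
    · rw [if_pos (by omega)]; simp; omega
    · intro s hs
      rw [Finset.mem_range] at hs
      apply bd_pair
      by_cases h : 2 * s + 2 < n
      · exact noact_ne hx s h
      · rw [noact_even hx s (by omega), show 2 * s + 2 = n by omega, nn_self]
        have : s % 2 = 1 := by omega
        simp [this]
  · have : ∑ t ∈ Finset.range n, bd x (nn n t) = ∑ t ∈ Finset.range (2 * m + 1), bd x (nn n t) :=
      Finset.sum_congr (congrArg Finset.range hm) fun _ _ => rfl
    rw [this, Finset.sum_range_succ, sum_range_two_mul', Finset.sum_congr rfl (g := fun _ => 1)]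
    · have e : n / 2 = m := by omega
      rw [if_neg (by omega), e]
      simp only [Finset.sum_const, Finset.card_range, smul_eq_mul, mul_one, bd, nn_succ]
      rw [← hm, nn_self, noact_even hx m (by omega)]
      rcases Nat.mod_two_eq_zero_or_one m with h | h <;> simp [h]
    · intro s hs
      rw [Finset.mem_range] at hs
      exact bd_pair x s (noact_ne hx s (by omega))

theorem exists_noact : ∃ x : St n, ¬ ∃ t, actv x t := by
  refine ⟨fun i => decide (i.val / 2 % 2 = 1), ?_⟩
  rintro ⟨t, h1, h2, h3⟩
  simp only [nn_of_lt (show t - 1 < n by omega), nn_of_lt h2, decide_eq_decide] at h3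
  omega

theorem sum_sgw_ne (hn : 3 ≤ n) (h4 : n % 4 ≠ 2) : ∑ x : St n, sgw x ≠ 0 := by
  rw [sum_sgw_eq hn, Finset.sum_congr rfl
    (g := fun _ => (-1 : ℤ) ^ ((n / 2 + (if n % 2 = 0 then 0 else (n / 2) % 2)) / 2))]
  · rw [Finset.sum_const]
    obtain ⟨x, hx⟩ := exists_noact (n := n)
    have : (Finset.univ.filter (fun x : St n => ¬ ∃ t, actv x t)).card ≠ 0 := by
      rw [Finset.card_ne_zero]
      exact ⟨x, by simpa using hx⟩
    simp only [nsmul_eq_mul]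
    refine mul_ne_zero (by exact_mod_cast this) (pow_ne_zero _ (by norm_num))
  · intro x hx
    simp only [Finset.mem_filter, Finset.mem_univ, true_and] at hx
    rw [sgw, ww_noact hn h4 hx]

theorem rank_lt_of_mod {k : Type*} [Field k] (hn : 3 ≤ n) (h4 : n % 4 ≠ 2) (a c : Fin n → k) :
    (QM a c).rank < 2 ^ (n - 1) := by
  have hmove : ∀ y z : St n, QM a c y z ≠ 0 → sgw y = - sgw z := by
    intro y z h
    obtain ⟨i, -, hi⟩ := Finset.exists_ne_zero_of_sum_ne_zero h
    rw [ite_ne_right_iff] at hi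
    obtain ⟨⟨h1, h2⟩, -⟩ := hi
    have : y = fl i z := by rw [h1, fl_fl]
    rw [this, sgw_fl hn i z h2]
  have r1 := rank_le_of_bip' (QM a c) (QM_sq hn a c) (fun x => sgw x = 1)
    (by
      intro y z hy hz
      by_contra h
      have := hmove y z h
      rcases sgw_cases y with h1 | h1 <;> rcases sgw_cases z with h2 | h2 <;> simp_all)
    (by
      intro y z hy hz
      by_contra h
      have := hmove y z h
      rw [hy, hz] at this
      norm_num at this)
  have r2 := rank_le_of_bip' (QM a c) (QM_sq hn a c) (fun x => ¬ sgw x = 1)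
    (by
      intro y z hy hz
      by_contra h
      have := hmove y z h
      rw [not_not.1 hy, not_not.1 hz] at this
      norm_num at this)
    (by
      intro y z hy hz
      by_contra h
      have := hmove y z h
      rcases sgw_cases y with h1 | h1 <;> rcases sgw_cases z with h2 | h2 <;> simp_all)
  have hs := sum_sgw_ne hn h4
  have hcard := Finset.card_filter_add_card_filter_not (s := (Finset.univ : Finset (St n)))
    (fun x => sgw x = 1)
  rw [Finset.card_univ, Fintype.card_fun, Fintype.card_bool, Fintype.card_fin] at hcard
  have hsum : ∑ x : St n, sgw x = ((Finset.univ.filter (fun x : St n => sgw x = 1)).card : ℤ)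
      - (Finset.univ.filter (fun x : St n => ¬ sgw x = 1)).card := by
    rw [← Finset.sum_filter_add_sum_filter_not Finset.univ (fun x : St n => sgw x = 1),
      Finset.sum_congr rfl (g := fun _ => (1 : ℤ)),
      Finset.sum_congr (s₁ := Finset.univ.filter (fun x : St n => ¬ sgw x = 1)) rfl
        (g := fun _ => (-1 : ℤ))]
    · simp; ring
    · intro x hx
      rcases sgw_cases x with h | h
      · simp [h] at hx
      · exact h
    · intro x hx
      simpa using hx
  rw [hsum] at hs
  obtain ⟨m, rfl⟩ : ∃ m, n = m + 1 := ⟨n - 1, by omega⟩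
  rw [pow_succ] at hcard
  simp only [Nat.add_sub_cancel]
  omega

end sites


/-! ### The cyclic linear system -/

theorem cyc_aux {k : Type*} [Field k] (N : ℕ) (hN : 0 < N) (α β : ℕ → k)
    (hα : ∀ j, α (j + N) = α j) (hβ : ∀ j, β (j + N) = β j) (d : ℕ) (hd : d < N)
    (h1 : d + 1 < N → α d = 0) (h2 : d + 1 < N → β (N - 1) = 0)
    (h3 : d + 1 = N → ∏ s ∈ Finset.range N, (-α s) = ∏ s ∈ Finset.range N, β s)
    (hnz : (∀ s < d, α s ≠ 0) ∨ (∀ s < d, β s ≠ 0)) :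
    ∃ v : ℕ → k, (∀ j, v (j + N) = v j) ∧ (∃ j, v j ≠ 0) ∧
      ∀ j, α j * v j + β j * v (j + 1) = 0 := by
  set u : ℕ → k := fun t => if t ≤ d then
    (∏ s ∈ Finset.range t, (-α s)) * ∏ s ∈ Finset.Ico t d, β s else 0 with hu
  have hαm : ∀ j, α j = α (j % N) := fun j => (Function.Periodic.map_mod_nat hα j).symm
  have hβm : ∀ j, β j = β (j % N) := fun j => (Function.Periodic.map_mod_nat hβ j).symm
  refine ⟨fun j => u (j % N), fun j => by simp, ?_, ?_⟩
  · rcases hnz with h | h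
    · refine ⟨d, ?_⟩
      beta_reduce
      rw [Nat.mod_eq_of_lt hd]
      simp only [hu, le_refl, if_true, Finset.Ico_self, Finset.prod_empty, mul_one]
      rw [Finset.prod_ne_zero_iff]
      intro s hs
      exact neg_ne_zero.2 (h s (Finset.mem_range.1 hs))
    · refine ⟨0, ?_⟩
      beta_reduce
      rw [Nat.zero_mod]
      simp only [hu, Nat.zero_le, if_true, Finset.range_zero, Finset.prod_empty, one_mul]
      rw [Finset.prod_ne_zero_iff]
      intro s hs
      exact h s (Finset.mem_Ico.1 hs).2
  · intro j
    beta_reduce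
    rw [hαm j, hβm j]
    have hlt := Nat.mod_lt j hN
    have hs : (j + 1) % N = if j % N + 1 < N then j % N + 1 else 0 := by
      rw [← Nat.mod_add_mod]
      split_ifs with h
      · exact Nat.mod_eq_of_lt h
      · rw [show j % N + 1 = N by omega, Nat.mod_self]
    rw [hs]
    generalize j % N = r at hlt
    rcases lt_trichotomy r d with h | h | h
    · rw [if_pos (by omega)]
      simp only [hu]
      rw [if_pos h.le, if_pos (by omega), Finset.prod_range_succ, Finset.prod_eq_prod_Ico_succ_bot h]
      ring
    · subst h
      by_cases hr : r + 1 < N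
      · rw [if_pos hr, h1 hr]
        simp [hu]
      · have hr' : r + 1 = N := by omega
        rw [if_neg hr]
        have := h3 hr'
        rw [← hr', Finset.prod_range_succ, Finset.prod_range_succ] at this
        simp [hu]
        rw [Finset.prod_neg] at this ⊢ 
        linear_combination (-1) * this
    · have hu0 : u r = 0 := by simp [hu, h]
      rw [hu0]
      by_cases hr : r + 1 < N
      · rw [if_pos hr]
        have : u (r + 1) = 0 := by simp [hu]; omega
        rw [this]; ring
      · have : r = N - 1 := by omega
        rw [this, h2 (by omega)]; ring

theorem cyc_lemma {k : Type*} [Field k] (N : ℕ) (hN : 0 < N) (α β : ℕ → k)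
    (hα : ∀ j, α (j + N) = α j) (hβ : ∀ j, β (j + N) = β j)
    (h : ∏ s ∈ Finset.range N, (-α s) = ∏ s ∈ Finset.range N, β s) :
    ∃ v : ℕ → k, (∀ j, v (j + N) = v j) ∧ (∃ j, v j ≠ 0) ∧
      ∀ j, α j * v j + β j * v (j + 1) = 0 := by
  by_cases hb : ∀ s < N, β s ≠ 0
  · exact cyc_aux N hN α β hα hβ (N - 1) (by omega) (by omega) (by omega) (fun _ => h)
      (Or.inr fun s hs => hb s (by omega))
  · push Not at hb
    obtain ⟨r, hr, hr0⟩ := hb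
    have h0 : ∏ s ∈ Finset.range N, (-α s) = 0 := by
      rw [h]; exact Finset.prod_eq_zero (Finset.mem_range.2 hr) hr0
    obtain ⟨e, he, he0⟩ := Finset.prod_eq_zero_iff.1 h0
    rw [neg_eq_zero] at he0
    rw [Finset.mem_range] at he
    have hex : ∃ d, α (d + r + 1) = 0 := by
      refine ⟨e + (N - 1 - r), ?_⟩
      rw [show e + (N - 1 - r) + r + 1 = e + N by omega, hα, he0]
    have hspec := Nat.find_spec hex
    have hmin : ∀ s < Nat.find hex, α (s + r + 1) ≠ 0 := fun s hs => Nat.find_min hex hs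
    have hd : Nat.find hex < N := by
      by_contra hc
      apply hmin (Nat.find hex - N) (by omega)
      rw [← hα, show Nat.find hex - N + r + 1 + N = Nat.find hex + r + 1 by omega]
      exact hspec
    obtain ⟨v, hv1, ⟨j0, hv2⟩, hv3⟩ := cyc_aux N hN (fun j => α (j + r + 1)) (fun j => β (j + r + 1))
      (fun j => by rw [← hα (j + r + 1)]; congr 1; ring)
      (fun j => by rw [← hβ (j + r + 1)]; congr 1; ring)
      (Nat.find hex) hd (fun _ => hspec)
      (fun _ => by
        have : N - 1 + r + 1 = r + N := by omega
        simp only [this, hβ, hr0])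
      (fun hh => by
        rw [Finset.prod_eq_zero (Finset.mem_range.2 hd), Finset.prod_eq_zero (i := N - 1)]
        · simp; omega
        · have : N - 1 + r + 1 = r + N := by omega
          simp only [this, hβ, hr0]
        · simp [hspec])
      (Or.inl hmin)
    refine ⟨fun j => v (j + (N - 1 - r)), fun j => ?_, ⟨j0 + r + 1, ?_⟩, fun j => ?_⟩
    · beta_reduce
      rw [← hv1 (j + (N - 1 - r))]; congr 1; ring
    · beta_reduce
      rw [show j0 + r + 1 + (N - 1 - r) = j0 + N by omega, hv1]
      exact hv2
    · have := hv3 (j + (N - 1 - r))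
      beta_reduce at this
      rw [show j + (N - 1 - r) + r + 1 = j + N by omega, hα, hβ] at this
      beta_reduce
      rw [show j + 1 + (N - 1 - r) = j + (N - 1 - r) + 1 by omega]
      exact this


/-! ### The loop of states -/

section loop
variable {n : ℕ} [NeZero n]

def lop (n : ℕ) [NeZero n] (j : ℕ) : St n := fun i => decide ((j + (i - nn n (2 * j)).val / 2) % 2 = 1)

theorem lop_nn (j r : ℕ) (hr : r < n) : lop n j (nn n (2 * j + r)) = decide ((j + r / 2) % 2 = 1) := by
  unfold lop
  rw [← nn_add, add_sub_cancel_left, nn_of_lt hr]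

theorem exists_nn (j : ℕ) (i : Fin n) : ∃ r < n, i = nn n (2 * j + r) := by
  refine ⟨(i - nn n (2 * j)).val, Fin.isLt _, ?_⟩
  rw [← nn_add, nn_coe]; abel

theorem lop_ext {j : ℕ} {x y : St n} (h : ∀ r < n, x (nn n (2 * j + r)) = y (nn n (2 * j + r))) :
    x = y := by
  funext i
  obtain ⟨r, hr, rfl⟩ := exists_nn j i
  exact h r hr

variable {m : ℕ} (hm : n = 2 * m) (hm2 : m % 2 = 1) (hn : 4 ≤ n)
include hm hm2 hn

theorem lop_mid (j r : ℕ) (h1 : 1 ≤ r) (h2 : r + 1 < n) :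
    lop n j (nn n (2 * j + r) - 1) ≠ lop n j (nn n (2 * j + r) + 1) := by
  obtain ⟨s, rfl⟩ : ∃ s, r = s + 1 := ⟨r - 1, by omega⟩
  rw [nn_succ, ← add_assoc, nn_pred, lop_nn j s (by omega),
    show 2 * j + s + 1 + 1 = 2 * j + (s + 2) by ring, lop_nn j (s + 2) (by omega)]
  intro h
  rw [decide_eq_decide] at h
  omega

theorem lop_src0 (j : ℕ) : src (nn n (2 * j)) (lop n j) := by
  have h0 := lop_nn (n := n) j 0 (by omega)
  have h1 := lop_nn (n := n) j 1 (by omega)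
  have h2 := lop_nn (n := n) j (n - 1) (by omega)
  have e : nn n (2 * j) - 1 = nn n (2 * j + (n - 1)) := by
    rw [← nn_add_self (2 * j), show 2 * j + n = 2 * j + (n - 1) + 1 by omega, nn_pred]
  unfold src
  rw [e, nn_succ, h1, h2]
  rw [add_zero] at h0
  rw [h0]
  constructor <;> rw [decide_eq_decide] <;> omega

theorem lop_src1 (j : ℕ) : src (nn n (2 * j + (n - 1))) (lop n j) := by
  have h0 := lop_nn (n := n) j 0 (by omega)
  have h1 := lop_nn (n := n) j (n - 2) (by omega)
  have h2 := lop_nn (n := n) j (n - 1) (by omega)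
  have e : nn n (2 * j + (n - 1)) - 1 = nn n (2 * j + (n - 2)) := by
    rw [show 2 * j + (n - 1) = 2 * j + (n - 2) + 1 by omega, nn_pred]
  have e2 : nn n (2 * j + (n - 1)) + 1 = nn n (2 * j + 0) := by
    rw [nn_succ, show 2 * j + (n - 1) + 1 = 2 * j + 0 + n by omega, nn_add_self]
  unfold src
  rw [e, e2, h1, h2, h0]
  constructor <;> rw [decide_eq_decide] <;> omega

theorem lop_src_iff (j : ℕ) (i : Fin n) :
    lop n j (i - 1) = lop n j (i + 1) ↔ (i = nn n (2 * j) ∨ i = nn n (2 * j + (n - 1))) := by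
  constructor
  · intro h
    obtain ⟨r, hr, rfl⟩ := exists_nn j i
    by_cases h1 : 1 ≤ r
    · by_cases h2 : r + 1 < n
      · exact absurd h (lop_mid hm hm2 hn j r h1 h2)
      · right; rw [show r = n - 1 by omega]
    · left; rw [show r = 0 by omega, add_zero]
  · rintro (rfl | rfl)
    · have := lop_src0 hm hm2 hn j
      rw [this.1, this.2]
    · have := lop_src1 hm hm2 hn j
      rw [this.1, this.2]

theorem lop_not_tgt (j : ℕ) (i : Fin n) : ¬ src i (fl i (lop n j)) := by
  intro h
  apply src_fl_not i (by omega) _ h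
  have h1 : lop n j (i - 1) = lop n j (i + 1) := by
    have := h.1.trans h.2.symm
    rwa [fl_ne (fin_pred_ne (by omega) i), fl_ne (fin_succ_ne (by omega) i)] at this
  rcases (lop_src_iff hm hm2 hn j i).1 h1 with rfl | rfl
  · exact lop_src0 hm hm2 hn j
  · exact lop_src1 hm hm2 hn j

theorem lop_succ (j : ℕ) : lop n (j + 1) = fl (nn n (2 * j + 1)) (fl (nn n (2 * j)) (lop n j)) := by
  have hne : nn n (2 * j + 1) ≠ nn n (2 * j) := by
    rw [← nn_succ]; exact fin_succ_ne (by omega) _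
  apply lop_ext (j := j)
  intro r hr
  by_cases h0 : r = 0
  · subst h0
    rw [add_zero, fl_ne hne.symm, fl_same, ← add_zero (2 * j), lop_nn j 0 (by omega),
      ← nn_add_self, show 2 * j + 0 + n = 2 * (j + 1) + (n - 2) by omega, lop_nn _ _ (by omega),
      ← decide_not, decide_eq_decide]
    omega
  by_cases h1 : r = 1
  · subst h1
    rw [fl_same, fl_ne hne, lop_nn j 1 (by omega),
      ← nn_add_self, show 2 * j + 1 + n = 2 * (j + 1) + (n - 1) by omega, lop_nn _ _ (by omega),
      ← decide_not, decide_eq_decide]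
    omega
  · rw [fl_ne, fl_ne, lop_nn j r hr, show 2 * j + r = 2 * (j + 1) + (r - 2) by omega,
      lop_nn _ _ (by omega), decide_eq_decide]
    · omega
    · intro h
      rw [← nn_add] at h
      have := add_left_cancel (h.trans (show nn n (2 * j) = nn n (2 * j) + nn n 0 by rw [nn_add, add_zero]))
      rw [nn_eq_of_lt (by omega) (by omega)] at this
      omega
    · rw [← nn_add, ← nn_add]
      intro h
      have := add_left_cancel h
      rw [nn_eq_of_lt (by omega) (by omega)] at this
      omega

theorem lop_half (j : ℕ) : lop n (j + m) = cpl (lop n j) := by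
  apply lop_ext (j := j)
  intro r hr
  unfold cpl
  rw [lop_nn j r hr, ← nn_add_self, show 2 * j + r + n = 2 * (j + m) + r by omega,
    lop_nn _ r hr, ← decide_not, decide_eq_decide]
  omega

theorem lop_per (j : ℕ) : lop n (j + n) = lop n j := by
  rw [show j + n = j + m + m by omega, lop_half hm hm2 hn, lop_half hm hm2 hn]
  funext i; simp [cpl]

theorem lop_inj (j l : ℕ) (hj : j < n) (hl : l < n) (h : lop n j = lop n l) : j = l := by
  have h1 : nn n (2 * j) = nn n (2 * l) := by
    have h2 := (lop_src_iff hm hm2 hn l (nn n (2 * j))).1 (by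
      rw [← h]; exact (lop_src_iff hm hm2 hn j _).2 (Or.inl rfl))
    rcases h2 with h2 | h2
    · exact h2
    · exfalso
      rw [nn_eq_iff] at h2
      have h3 := congrArg (· % 2) h2
      beta_reduce at h3
      have hdvd : 2 ∣ n := ⟨m, hm⟩
      rw [Nat.mod_mod_of_dvd _ hdvd, Nat.mod_mod_of_dvd _ hdvd] at h3
      omega
  rw [nn_eq_iff, hm, Nat.mul_mod_mul_left, Nat.mul_mod_mul_left] at h1
  have hne : ∀ x : St n, cpl x ≠ x := by
    intro x hx
    have := congrFun hx 0
    simp [cpl] at this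
  rw [hm] at hj hl
  by_cases h1j : j < m <;> by_cases h1l : l < m
  · rw [Nat.mod_eq_of_lt h1j, Nat.mod_eq_of_lt h1l] at h1; omega
  · rw [Nat.mod_eq_of_lt h1j, Nat.mod_eq_sub_mod (by omega), Nat.mod_eq_of_lt (by omega)] at h1
    have h5 : l = j + m := by omega
    rw [h5, lop_half hm hm2 hn] at h
    exact absurd h.symm (hne _)
  · rw [Nat.mod_eq_of_lt h1l, Nat.mod_eq_sub_mod (by omega), Nat.mod_eq_of_lt (by omega)] at h1
    have h5 : j = l + m := by omega
    rw [h5, lop_half hm hm2 hn] at h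
    exact absurd h (hne _)
  · rw [Nat.mod_eq_sub_mod (by omega), Nat.mod_eq_of_lt (by omega),
      Nat.mod_eq_sub_mod (by omega), Nat.mod_eq_of_lt (by omega)] at h1
    omega

omit hm hm2 hn in
theorem prod_two_halves {k : Type*} [Field k] (f : ℕ → k) :
    ∏ j ∈ Finset.range (2 * m), f j = ∏ j ∈ Finset.range m, (f j * f (j + m)) := by
  rw [two_mul, Finset.prod_range_add, Finset.prod_mul_distrib]
  congr 1
  exact Finset.prod_congr rfl fun x _ => by rw [add_comm]

omit hm hm2 hn in
theorem sum_range_shift {k : Type*} [Field k] (N : ℕ) (f : ℕ → k) (hf : f N = f 0) :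
    ∑ j ∈ Finset.range N, f (j + 1) = ∑ j ∈ Finset.range N, f j := by
  have h1 := Finset.sum_range_succ f N
  have h2 := Finset.sum_range_succ' f N
  rw [h1, hf] at h2
  exact (add_right_cancel h2).symm

theorem QM_lp {k : Type*} [Field k] (a c : Fin n → k) (j : ℕ) (y : St n) :
    QM a c y (lop n j) = (if y = fl (nn n (2 * j)) (lop n j) then qq a c (nn n (2 * j)) (lop n j) else 0)
      + (if y = fl (nn n (2 * j + (n - 1))) (lop n j)
          then qq a c (nn n (2 * j + (n - 1))) (lop n j) else 0) := by
  have hne : nn n (2 * j) ≠ nn n (2 * j + (n - 1)) := by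
    rw [← add_zero (2 * j), add_assoc, ← nn_add, ← nn_add]
    intro h
    have := add_left_cancel h
    rw [nn_eq_of_lt (by omega) (by omega)] at this
    omega
  have hiff : ∀ i, lop n j = fl i y ↔ y = fl i (lop n j) := fun i =>
    ⟨fun h => by rw [h, fl_fl], fun h => by rw [h, fl_fl]⟩
  unfold QM
  rw [← Finset.sum_subset (Finset.subset_univ {nn n (2 * j), nn n (2 * j + (n - 1))}),
    Finset.sum_pair hne]
  · simp only [hiff, lop_src0 hm hm2 hn j, lop_src1 hm hm2 hn j, and_true]
  · intro i _ hi
    rw [if_neg]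
    rintro ⟨-, h⟩
    apply hi
    have := (lop_src_iff hm hm2 hn j i).1 (by rw [h.1, h.2])
    simpa using this

theorem rank_lt_of_loop {k : Type*} [Field k] (a c : Fin n → k)
    (hp : ∏ j ∈ Finset.range m, (a (nn n (2 * j)) * c (nn n (2 * j))) +
      ∏ j ∈ Finset.range m, (a (nn n (2 * j + 1)) * c (nn n (2 * j + 1))) = 0) :
    (QM a c).rank < 2 ^ (n - 1) := by
  set α : ℕ → k := fun j => qq a c (nn n (2 * j)) (lop n j) with hα
  set β : ℕ → k := fun j => qq a c (nn n (2 * j + 1)) (lop n (j + 1)) with hβ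
  have per2 : ∀ j, nn n (2 * (j + n)) = nn n (2 * j) := by
    intro j; rw [show 2 * (j + n) = 2 * j + n + n by ring, nn_add_self, nn_add_self]
  have per3 : ∀ j, nn n (2 * (j + n) + 1) = nn n (2 * j + 1) := by
    intro j; rw [show 2 * (j + n) + 1 = 2 * j + 1 + n + n by ring, nn_add_self, nn_add_self]
  have hαp : ∀ j, α (j + n) = α j := by
    intro j; simp only [hα, per2, lop_per hm hm2 hn]
  have hβp : ∀ j, β (j + n) = β j := by
    intro j; simp only [hβ, per3, show j + n + 1 = j + 1 + n by ring, lop_per hm hm2 hn]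
  have hαprod : ∏ j ∈ Finset.range n, (-α j)
      = ∏ j ∈ Finset.range m, (a (nn n (2 * j)) * c (nn n (2 * j))) := by
    have e : ∏ j ∈ Finset.range n, (-α j) = ∏ j ∈ Finset.range (2 * m), (-α j) := by rw [← hm]
    rw [e, prod_two_halves]
    refine Finset.prod_congr rfl fun j hj => ?_
    rw [Finset.mem_range] at hj
    have e2 : nn n (2 * (j + m)) = nn n (2 * j) := by
      rw [show 2 * (j + m) = 2 * j + n by omega, nn_add_self]
    simp only [hα, e2, lop_half hm hm2 hn, neg_mul_neg, qq_compl]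
    rw [nn_of_lt (by omega), pow_mul]
    simp
  have hβprod : ∏ j ∈ Finset.range n, β j
      = - ∏ j ∈ Finset.range m, (a (nn n (2 * j + 1)) * c (nn n (2 * j + 1))) := by
    have e : ∏ j ∈ Finset.range n, β j = ∏ j ∈ Finset.range (2 * m), β j := by rw [← hm]
    have e3 : ∏ j ∈ Finset.range m, (a (nn n (2 * j + 1)) * c (nn n (2 * j + 1)))
        = - ∏ j ∈ Finset.range m, (-(a (nn n (2 * j + 1)) * c (nn n (2 * j + 1)))) := by
      rw [Finset.prod_neg, Finset.card_range, Odd.neg_one_pow (Nat.odd_iff.2 hm2)]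
      ring
    rw [e, prod_two_halves, e3, neg_neg]
    refine Finset.prod_congr rfl fun j hj => ?_
    rw [Finset.mem_range] at hj
    have e2 : nn n (2 * (j + m) + 1) = nn n (2 * j + 1) := by
      rw [show 2 * (j + m) + 1 = 2 * j + 1 + n by omega, nn_add_self]
    simp only [hβ, e2, show j + m + 1 = j + 1 + m by ring, lop_half hm hm2 hn, qq_compl]
    rw [nn_of_lt (by omega), pow_succ, pow_mul]
    simp
  obtain ⟨v, hv1, ⟨j0, hv2⟩, hv3⟩ := cyc_lemma n (by omega) α β hαp hβp (by
    rw [hαprod, hβprod]; linear_combination hp)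
  have hj0 : v (j0 % n) ≠ 0 := by
    rw [Function.Periodic.map_mod_nat hv1]; exact hv2
  set j1 := j0 % n with hj1
  have hj1n : j1 < n := Nat.mod_lt _ (by omega)
  set w : St n → k := fun x => ∑ j ∈ Finset.range n, if x = lop n j then v j else 0 with hw
  have hwj : w (lop n j1) = v j1 := by
    simp only [hw]
    rw [Finset.sum_eq_single j1]
    · simp
    · intro j hj hne
      rw [if_neg]
      intro h
      exact hne (lop_inj hm hm2 hn _ _ hj1n (Finset.mem_range.1 hj) h).symm
    · intro h; exact absurd (Finset.mem_range.2 hj1n) h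
  have hrank := rank_lt_of_ker (QM a c) (QM_sq (by omega) a c) w ?_ ?_
  · rw [Fintype.card_fun, Fintype.card_bool, Fintype.card_fin,
      show 2 ^ n = 2 ^ (n - 1) * 2 by rw [← pow_succ]; congr 1; omega] at hrank
    omega
  · funext y
    simp only [Matrix.mulVec, dotProduct, hw, Finset.mul_sum, Pi.zero_apply]
    rw [Finset.sum_comm]
    have h1 : ∀ j ∈ Finset.range n, (∑ x : St n, QM a c y x * (if x = lop n j then v j else 0))
        = QM a c y (lop n j) * v j := by
      intro j _
      rw [Finset.sum_eq_single (lop n j)]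
      · simp
      · intro x _ hx; simp [hx]
      · simp
    rw [Finset.sum_congr rfl h1]
    simp only [QM_lp hm hm2 hn, add_mul]
    rw [Finset.sum_add_distrib, ← sum_range_shift n (fun j => (if y = fl (nn n (2 * j + (n - 1))) (lop n j)
          then qq a c (nn n (2 * j + (n - 1))) (lop n j) else 0) * v j), ← Finset.sum_add_distrib]
    · apply Finset.sum_eq_zero
      intro j _
      have e : nn n (2 * (j + 1) + (n - 1)) = nn n (2 * j + 1) := by
        rw [show 2 * (j + 1) + (n - 1) = 2 * j + 1 + n by omega, nn_add_self]
      have e2 : fl (nn n (2 * j + 1)) (lop n (j + 1)) = fl (nn n (2 * j)) (lop n j) := by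
        rw [lop_succ hm hm2 hn, fl_fl]
      rw [e, e2]
      have := hv3 j
      simp only [hα, hβ] at this
      split_ifs
      · exact this
      · ring
    · have e : nn n (2 * n + (n - 1)) = nn n (2 * 0 + (n - 1)) := by
        rw [show 2 * n + (n - 1) = 2 * 0 + (n - 1) + n + n by omega, nn_add_self, nn_add_self]
      have e3 := lop_per hm hm2 hn 0
      have e4 := hv1 0
      rw [zero_add] at e3 e4
      rw [e, e3, e4]
  · intro u hu
    have h1 := congrFun hu (lop n j1)
    rw [QM_mulVec, hwj, Finset.sum_eq_zero] at h1
    · exact hj0 h1.symm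
    · intro i _
      rw [if_neg (lop_not_tgt hm hm2 hn j1 i)]

end loop


/-! ### Elimination -/

def nfl (t : ℕ) (x : ℕ → Bool) : ℕ → Bool := fun s => if s = t then !x s else x s

def nflB (K : ℕ) (x : ℕ → Bool) : ℕ → Bool := fun s => if s < K then !x s else x s

def lft (n t : ℕ) : ℕ := if t = 0 then n - 1 else t - 1
def rgt (n t : ℕ) : ℕ := if t + 1 = n then 0 else t + 1

def CC (K : ℕ) (x : ℕ → Bool) : Prop := ∀ s < K, x (2 * s) ≠ x (2 * s + 2)

def IsTgt (n : ℕ) (x : ℕ → Bool) : Prop :=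
  ∃ s, 2 * s + 1 < n ∧ CC s x ∧ x (2 * s) = x (rgt n (2 * s + 1)) ∧ x (2 * s + 1) ≠ x (2 * s)

section elim
variable {k : Type*} [Field k]

def EE (n : ℕ) (q : ℕ → (ℕ → Bool) → k) (v : (ℕ → Bool) → k) (t : ℕ) (z : ℕ → Bool) : k :=
  if z (lft n t) = z t ∧ z (rgt n t) = z t then q t z * v z else 0

def phi (q : ℕ → (ℕ → Bool) → k) : ℕ → (ℕ → Bool) → k
  | 0 => q 0
  | K + 1 => fun σ =>
    if σ (2 * K + 1) = σ (2 * K) then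
      - q (2 * K + 2) (nflB (2 * K + 2) σ) / q (2 * K + 1) (nflB (2 * K + 2) σ) * phi q K σ
    else - phi q K (nfl (2 * K + 1) (nfl (2 * K + 2) σ)) /
      q (2 * K + 1) (nfl (2 * K + 1) (nfl (2 * K + 2) σ)) * q (2 * K + 2) σ

theorem phi_succ (q : ℕ → (ℕ → Bool) → k) (K : ℕ) (σ : ℕ → Bool) : phi q (K + 1) σ =
    if σ (2 * K + 1) = σ (2 * K) then
      - q (2 * K + 2) (nflB (2 * K + 2) σ) / q (2 * K + 1) (nflB (2 * K + 2) σ) * phi q K σ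
    else - phi q K (nfl (2 * K + 1) (nfl (2 * K + 2) σ)) /
      q (2 * K + 1) (nfl (2 * K + 1) (nfl (2 * K + 2) σ)) * q (2 * K + 2) σ := rfl

def FF (n : ℕ) (q : ℕ → (ℕ → Bool) → k) (v : (ℕ → Bool) → k) (K : ℕ) (z : ℕ → Bool) : k :=
  if z (n - 1) = z 0 ∧ z (2 * K + 1) = z (2 * K) then phi q K z * v z else 0

def EqK (n : ℕ) (q : ℕ → (ℕ → Bool) → k) (v : (ℕ → Bool) → k) (K : ℕ) : Prop :=
  ∀ y, CC K y → FF n q v K (nflB (2 * K + 1) y) +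
    ∑ t ∈ Finset.Ico (2 * K + 1) n, EE n q v t (nfl t y) = 0

theorem CC_congr {K : ℕ} {x y : ℕ → Bool}
    (h : ∀ s < K, (x (2 * s) = x (2 * s + 2) ↔ y (2 * s) = y (2 * s + 2))) : CC K x ↔ CC K y :=
  forall_congr' fun s => forall_congr' fun hs => not_congr (h s hs)

theorem CC_nfl {K t : ℕ} (h : 2 * K < t ∨ t % 2 = 1) (y : ℕ → Bool) : CC K (nfl t y) ↔ CC K y := by
  refine CC_congr fun s hs => ?_
  have h1 : ¬ (2 * s = t) := by omega
  have h2 : ¬ (2 * s + 2 = t) := by omega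
  simp [nfl, h1, h2]

theorem CC_nflB {K t : ℕ} (h : 2 * K < t) (y : ℕ → Bool) : CC K (nflB t y) ↔ CC K y := by
  refine CC_congr fun s hs => ?_
  have h1 : 2 * s < t := by omega
  have h2 : 2 * s + 2 < t := by omega
  simp [nflB, h1, h2]

theorem CC_succ {K : ℕ} {y : ℕ → Bool} : CC (K + 1) y ↔ CC K y ∧ y (2 * K) ≠ y (2 * K + 2) := by
  constructor
  · intro h
    exact ⟨fun s hs => h s (by omega), h K (by omega)⟩
  · rintro ⟨h1, h2⟩ s hs
    by_cases h : s = K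
    · subst h; exact h2
    · exact h1 s (by omega)

variable {n m : ℕ} (hm : n = 2 * m) (q : ℕ → (ℕ → Bool) → k) (v : (ℕ → Bool) → k)
  (hT : ∀ x, IsTgt n x → v x = 0)

include hm hT in
theorem star {K : ℕ} (hK : K + 2 ≤ m) (hEq : EqK n q v K) (z : ℕ → Bool) (hz : CC K z)
    (h1 : z (2 * K + 1) = z (2 * K)) (h2 : z (2 * K + 2) = z (2 * K)) :
    q (2 * K + 1) z * v z = - FF n q v K (nflB (2 * K + 1) (nfl (2 * K + 1) z))
      - EE n q v (2 * K + 2) (nfl (2 * K + 2) (nfl (2 * K + 1) z)) := by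
  have h := hEq (nfl (2 * K + 1) z) ((CC_nfl (by omega) z).2 hz)
  rw [Finset.sum_eq_sum_Ico_succ_bot (by omega), Finset.sum_eq_sum_Ico_succ_bot (by omega)] at h
  have e0 : nfl (2 * K + 1) (nfl (2 * K + 1) z) = z := by
    funext s; simp only [nfl]; split_ifs <;> simp
  have e1 : EE n q v (2 * K + 1) z = q (2 * K + 1) z * v z := by
    unfold EE
    have ha : lft n (2 * K + 1) = 2 * K := by simp [lft]
    have hb : rgt n (2 * K + 1) = 2 * K + 2 := by
      unfold rgt; rw [if_neg (by omega)]
    rw [ha, hb, if_pos ⟨h1.symm, by rw [h1, h2]⟩]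
  have e2 : ∑ t ∈ Finset.Ico (2 * K + 1 + 1 + 1) n, EE n q v t (nfl t (nfl (2 * K + 1) z)) = 0 := by
    refine Finset.sum_eq_zero fun t ht => ?_
    rw [Finset.mem_Ico] at ht
    have : v (nfl t (nfl (2 * K + 1) z)) = 0 := by
      apply hT
      refine ⟨K, by omega, ?_, ?_, ?_⟩
      · rw [CC_nfl (by omega), CC_nfl (by omega)]; exact hz
      · have hb : rgt n (2 * K + 1) = 2 * K + 2 := by
          unfold rgt; rw [if_neg (by omega)]
        rw [hb]
        have c1 : ¬ (2 * K = t) := by omega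
        have c2 : ¬ (2 * K + 2 = t) := by omega
        simp [nfl, c1, c2, h2]
      · have c1 : ¬ (2 * K = t) := by omega
        have c2 : ¬ (2 * K + 1 = t) := by omega
        simp [nfl, c1, c2, h1]
    unfold EE
    rw [this]; simp
  rw [e0, e1, e2] at h
  linear_combination h

variable (hq : ∀ t < n, t % 2 = 1 → t + 3 ≤ n → ∀ z, q t z ≠ 0)

set_option maxHeartbeats 2000000 in
include hm hT hq in
theorem eqK_step {K : ℕ} (hK : K + 2 ≤ m) (hEq : EqK n q v K) : EqK n q v (K + 1) := by
  intro y hy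
  rw [CC_succ] at hy
  obtain ⟨hyC, hyne⟩ := hy
  have h := hEq y hyC
  rw [Finset.sum_eq_sum_Ico_succ_bot (by omega), Finset.sum_eq_sum_Ico_succ_bot (by omega)] at h
  have l1 : lft n (2 * K + 1) = 2 * K := by simp [lft]
  have r1 : rgt n (2 * K + 1) = 2 * K + 2 := by
    unfold rgt; rw [if_neg (by omega)]
  have l2 : lft n (2 * K + 2) = 2 * K + 1 := by simp [lft]
  have r2 : rgt n (2 * K + 2) = 2 * K + 3 := by
    unfold rgt; rw [if_neg (by omega)]
  have e1 : EE n q v (2 * K + 1) (nfl (2 * K + 1) y) = 0 := by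
    unfold EE
    rw [l1, r1, if_neg]
    rintro ⟨g1, g2⟩
    rw [← g2] at g1
    simp [nfl] at g1
    exact hyne g1
  rw [e1, zero_add] at h
  have hqi := hq (2 * K + 1) (by omega) (by omega) (by omega)
  set σ := nflB (2 * (K + 1) + 1) y with hσ
  have n1 : ¬ (n - 1 < 2 * (K + 1) + 1) := by omega
  have n2 : ¬ (n - 1 < 2 * K + 1) := by omega
  have n3 : ¬ (n - 1 = 2 * K + 1) := by omega
  have n4 : ¬ (n - 1 = 2 * K + 2) := by omega
  have key : FF n q v K (nflB (2 * K + 1) y) + EE n q v (2 * K + 2) (nfl (2 * K + 2) y)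
      = FF n q v (K + 1) σ := by
    have hFσ : FF n q v (K + 1) σ = if (y (n - 1) = !y 0) ∧ (y (2 * K + 3) = !y (2 * K + 2))
        then phi q (K + 1) σ * v σ else 0 := by
      unfold FF
      have c1 : σ (n - 1) = y (n - 1) := by simp [hσ, nflB, n1]
      have c2 : σ 0 = !y 0 := by simp [hσ, nflB]
      have c3 : σ (2 * (K + 1) + 1) = y (2 * K + 3) := by simp [hσ, nflB]; ring_nf
      have c4 : σ (2 * (K + 1)) = !y (2 * K + 2) := by simp [hσ, nflB]; ring_nf
      rw [c1, c2, c3, c4]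
    by_cases hc : y (2 * K + 1) = y (2 * K + 2)
    · -- right case
      have hE0 : EE n q v (2 * K + 2) (nfl (2 * K + 2) y) = 0 := by
        unfold EE
        rw [l2, if_neg]
        rintro ⟨g1, -⟩
        simp [nfl, hc] at g1
      rw [hE0, add_zero]
      set zA := nflB (2 * K + 1) y with hzA
      have hst := star hm q v hT hK hEq zA ((CC_nflB (by omega) y).2 hyC)
        (by
          simp [hzA, nflB, hc]
          cases g1 : y (2 * K) <;> cases g2 : y (2 * K + 2) <;> simp_all)
        (by
          simp [hzA, nflB]
          cases g1 : y (2 * K) <;> cases g2 : y (2 * K + 2) <;> simp_all)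
      have e2 : nflB (2 * K + 1) (nfl (2 * K + 1) zA) = nfl (2 * K + 1) y := by
        funext s; simp only [hzA, nfl, nflB]; split_ifs <;> simp
      have e3 : nfl (2 * K + 2) (nfl (2 * K + 1) zA) = σ := by
        funext s; simp only [hzA, hσ, nfl, nflB]; split_ifs <;> first | omega | simp
      have e4 : nfl (2 * K + 1) (nfl (2 * K + 2) σ) = zA := by
        rw [← e3]; funext s; simp only [nfl]; split_ifs <;> first | omega | simp
      rw [e2, e3] at hst
      have hEσ : EE n q v (2 * K + 2) σ = if y (2 * K + 3) = !y (2 * K + 2) then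
          q (2 * K + 2) σ * v σ else 0 := by
        unfold EE
        have c1 : σ (2 * K + 1) = !y (2 * K + 2) := by simp [hσ, nflB, hc] <;> omega
        have c2 : σ (2 * K + 2) = !y (2 * K + 2) := by simp [hσ, nflB] <;> omega
        have c3 : σ (2 * K + 3) = y (2 * K + 3) := by simp [hσ, nflB] <;> omega
        rw [l2, r2, c1, c2, c3]
        simp
      have hFA : FF n q v K zA = if y (n - 1) = !y 0 then phi q K zA * v zA else 0 := by
        unfold FF
        have c1 : zA (n - 1) = y (n - 1) := by simp [hzA, nflB, n2]
        have c2 : zA 0 = !y 0 := by simp [hzA, nflB]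
        have c3 : zA (2 * K + 1) = y (2 * K + 2) := by simp [hzA, nflB, hc]
        have c4 : zA (2 * K) = !y (2 * K) := by simp [hzA, nflB]
        rw [c1, c2, c3, c4]
        congr 1
        simp only [eq_iff_iff, and_iff_left_iff_imp]
        intro _
        cases g1 : y (2 * K) <;> cases g2 : y (2 * K + 2) <;> simp_all
      rw [hFA, hFσ]
      by_cases hP : y (n - 1) = !y 0
      · have hF0 : FF n q v K (nfl (2 * K + 1) y) = 0 := by
          unfold FF
          rw [if_neg]
          rintro ⟨g1, -⟩
          simp [nfl, n3, hP] at g1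
        rw [hF0, hEσ] at hst
        rw [if_pos hP]
        have hφ : phi q (K + 1) σ = - phi q K zA / q (2 * K + 1) zA * q (2 * K + 2) σ := by
          have : ¬ σ (2 * K + 1) = σ (2 * K) := by
            have c1 : σ (2 * K + 1) = !y (2 * K + 2) := by simp [hσ, nflB, hc] <;> omega
            have c2 : σ (2 * K) = !y (2 * K) := by simp [hσ, nflB] <;> omega
            rw [c1, c2]
            cases g1 : y (2 * K) <;> cases g2 : y (2 * K + 2) <;> simp_all
          rw [phi_succ, if_neg this, e4]
        by_cases hR : y (2 * K + 3) = !y (2 * K + 2)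
        · rw [if_pos ⟨hP, hR⟩, hφ]
          rw [if_pos hR] at hst
          have := hqi zA
          field_simp
          linear_combination (phi q K zA) * hst
        · rw [if_neg (fun g => hR g.2)]
          rw [if_neg hR] at hst
          have : v zA = 0 := by
            have := hqi zA
            rw [neg_zero, sub_zero] at hst
            exact (mul_eq_zero.1 hst).resolve_left this
          rw [this, mul_zero]
      · rw [if_neg hP, if_neg (fun g => hP g.1)]
    · -- left case
      have hc' : y (2 * K + 1) = y (2 * K) := by
        cases g1 : y (2 * K) <;> cases g2 : y (2 * K + 2) <;> cases g3 : y (2 * K + 1) <;> simp_all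
      have hF0 : FF n q v K (nflB (2 * K + 1) y) = 0 := by
        unfold FF
        rw [if_neg]
        rintro ⟨-, g1⟩
        simp [nflB, hc'] at g1
      rw [hF0, zero_add]
      set zB := nfl (2 * K + 2) y with hzB
      have hst := star hm q v hT hK hEq zB ((CC_nfl (by omega) y).2 hyC)
        (by simp [hzB, nfl, hc'])
        (by
          simp [hzB, nfl]
          cases g1 : y (2 * K) <;> cases g2 : y (2 * K + 2) <;> simp_all)
      have e2 : nflB (2 * K + 1) (nfl (2 * K + 1) zB) = σ := by
        funext s; simp only [hzB, hσ, nfl, nflB]; split_ifs <;> first | omega | simp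
      have e3 : nfl (2 * K + 2) (nfl (2 * K + 1) zB) = nfl (2 * K + 1) y := by
        funext s; simp only [hzB, nfl]; split_ifs <;> first | omega | simp
      have e4 : nflB (2 * K + 2) σ = zB := by
        funext s; simp only [hzB, hσ, nfl, nflB]; split_ifs <;> first | omega | simp
      rw [e2, e3] at hst
      have hEB : EE n q v (2 * K + 2) zB = if y (2 * K + 3) = !y (2 * K + 2) then
          q (2 * K + 2) zB * v zB else 0 := by
        unfold EE
        have c1 : zB (2 * K + 1) = y (2 * K) := by simp [hzB, nfl, hc']
        have c2 : zB (2 * K + 2) = !y (2 * K + 2) := by simp [hzB, nfl]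
        have c3 : zB (2 * K + 3) = y (2 * K + 3) := by simp [hzB, nfl]
        rw [l2, r2, c1, c2, c3]
        congr 1
        simp only [eq_iff_iff, and_iff_right_iff_imp]
        intro _
        cases g1 : y (2 * K) <;> cases g2 : y (2 * K + 2) <;> simp_all
      have hFS : FF n q v K σ = if y (n - 1) = !y 0 then phi q K σ * v σ else 0 := by
        unfold FF
        have c1 : σ (n - 1) = y (n - 1) := by simp [hσ, nflB, n1]
        have c2 : σ 0 = !y 0 := by simp [hσ, nflB]
        have c3 : σ (2 * K + 1) = !y (2 * K) := by simp [hσ, nflB, hc'] <;> omega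
        have c4 : σ (2 * K) = !y (2 * K) := by simp [hσ, nflB] <;> omega
        rw [c1, c2, c3, c4]
        simp
      rw [hEB, hFσ]
      by_cases hR : y (2 * K + 3) = !y (2 * K + 2)
      · have hE0 : EE n q v (2 * K + 2) (nfl (2 * K + 1) y) = 0 := by
          unfold EE
          rw [r2, if_neg]
          rintro ⟨-, g1⟩
          simp [nfl, hR] at g1
        rw [hE0, hFS] at hst
        rw [if_pos hR]
        have hφ : phi q (K + 1) σ = - q (2 * K + 2) zB / q (2 * K + 1) zB * phi q K σ := by
          have : σ (2 * K + 1) = σ (2 * K) := by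
            have c3 : σ (2 * K + 1) = !y (2 * K) := by simp [hσ, nflB, hc'] <;> omega
            have c4 : σ (2 * K) = !y (2 * K) := by simp [hσ, nflB] <;> omega
            rw [c3, c4]
          rw [phi_succ, if_pos this, e4]
        by_cases hP : y (n - 1) = !y 0
        · rw [if_pos ⟨hP, hR⟩, hφ]
          rw [if_pos hP] at hst
          have := hqi zB
          field_simp
          linear_combination (q (2 * K + 2) zB) * hst
        · rw [if_neg (fun g => hP g.1)]
          rw [if_neg hP] at hst
          have : v zB = 0 := by
            have := hqi zB
            rw [neg_zero, sub_zero] at hst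
            exact (mul_eq_zero.1 hst).resolve_left this
          rw [this, mul_zero]
      · rw [if_neg hR, if_neg (fun g => hR g.2)]
  rw [← key]
  rw [show 2 * (K + 1) + 1 = 2 * K + 1 + 1 + 1 by ring]
  rw [← h]
  ring_nf

end elim

section elim2
variable {k : Type*} [Field k]

theorem nflB_nflB (K L : ℕ) (z : ℕ → Bool) : nflB K (nflB L z) = nflB L (nflB K z) := by
  funext s; simp only [nflB]; split_ifs <;> rfl

theorem nflB_self (K : ℕ) (z : ℕ → Bool) : nflB K (nflB K z) = z := by
  funext s; simp only [nflB]; split_ifs <;> simp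

theorem nfl_self (K : ℕ) (z : ℕ → Bool) : nfl K (nfl K z) = z := by
  funext s; simp only [nfl]; split_ifs <;> simp

theorem nfl_nflB (t L : ℕ) (z : ℕ → Bool) : nfl t (nflB L z) = nflB L (nfl t z) := by
  funext s; simp only [nfl, nflB]; split_ifs <;> rfl

theorem phi_prod {n m : ℕ} (hm : n = 2 * m) (q : ℕ → (ℕ → Bool) → k) (Y : ℕ → k)
    (hY : ∀ t < n, ∀ z, q t z * q t (nflB n z) = Y t)
    (hYne : ∀ t < n, t % 2 = 1 → Y t ≠ 0) (K : ℕ) (hK : K + 1 ≤ m) (z : ℕ → Bool) :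
    phi q K z * phi q K (nflB n z) * ∏ j ∈ Finset.range K, Y (2 * j + 1) =
      ∏ j ∈ Finset.range (K + 1), Y (2 * j) := by
  induction K generalizing z with
  | zero => simpa [phi] using hY 0 (by omega) z
  | succ K ih =>
    have hq : ∀ z, q (2 * K + 1) z ≠ 0 := fun z h => by
      apply hYne (2 * K + 1) (by omega) (by omega)
      rw [← hY _ (by omega) z, h, zero_mul]
    have hiff : (nflB n z (2 * K + 1) = nflB n z (2 * K)) ↔ z (2 * K + 1) = z (2 * K) := by
      have h1 : 2 * K + 1 < n := by omega
      have h2 : 2 * K < n := by omega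
      simp [nflB, h1, h2]
    rw [Finset.prod_range_succ, Finset.prod_range_succ _ (K + 1), phi_succ, phi_succ]
    by_cases h : z (2 * K + 1) = z (2 * K)
    · rw [if_pos h, if_pos (hiff.2 h), nflB_nflB (2 * K + 2) n, ← ih (by omega) z]
      rw [← hY (2 * K + 1) (by omega) (nflB (2 * K + 2) z),
        show 2 * (K + 1) = 2 * K + 2 by ring,
        ← hY (2 * K + 2) (by omega) (nflB (2 * K + 2) z)]
      have h1 := hq (nflB (2 * K + 2) z)
      have h2 := hq (nflB n (nflB (2 * K + 2) z))
      field_simp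
    · rw [if_neg h, if_neg (fun g => h (hiff.1 g)), nfl_nflB, nfl_nflB,
        ← ih (by omega) (nfl (2 * K + 1) (nfl (2 * K + 2) z))]
      rw [← hY (2 * K + 1) (by omega) (nfl (2 * K + 1) (nfl (2 * K + 2) z)),
        show 2 * (K + 1) = 2 * K + 2 by ring,
        ← hY (2 * K + 2) (by omega) z]
      have h1 := hq (nfl (2 * K + 1) (nfl (2 * K + 2) z))
      have h2 := hq (nflB n (nfl (2 * K + 1) (nfl (2 * K + 2) z)))
      field_simp

theorem CC_alt {K : ℕ} {x : ℕ → Bool} (h : CC (2 * K) x) : x (4 * K) = x 0 := by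
  induction K with
  | zero => rfl
  | succ K ih =>
    rw [← ih (fun s hs => h s (by omega))]
    have h1 := h (2 * K) (by omega)
    have h2 := h (2 * K + 1) (by omega)
    rw [show 2 * (2 * K) = 4 * K by ring] at h1
    rw [show 2 * (2 * K + 1) = 4 * K + 2 by ring] at h2
    rw [show 4 * (K + 1) = 4 * K + 2 + 2 by ring]
    revert h1 h2
    generalize x (4 * K) = a
    generalize x (4 * K + 2) = b
    generalize x (4 * K + 2 + 2) = c
    revert a b c
    decide

theorem elim_main {n m : ℕ} (hm : n = 2 * m) (hm2 : m % 2 = 1) (hn : 4 ≤ n)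
    (q : ℕ → (ℕ → Bool) → k) (v : (ℕ → Bool) → k) (hT : ∀ x, IsTgt n x → v x = 0) (Y : ℕ → k)
    (hY : ∀ t < n, ∀ z, q t z * q t (nflB n z) = Y t)
    (hYne : ∀ t < n, t % 2 = 1 → Y t ≠ 0)
    (hdet : ∏ j ∈ Finset.range m, Y (2 * j + 1) ≠ ∏ j ∈ Finset.range m, Y (2 * j))
    (hQ : ∀ y, ∑ t ∈ Finset.range n, EE n q v t (nfl t y) = 0) (z : ℕ → Bool) : v z = 0 := by
  have hq : ∀ t < n, t % 2 = 1 → t + 3 ≤ n → ∀ z, q t z ≠ 0 := fun t ht h1 _ z h => by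
    apply hYne t ht h1
    rw [← hY _ ht z, h, zero_mul]
  have E : ∀ K, K + 1 ≤ m → EqK n q v K := by
    intro K
    induction K with
    | zero =>
      intro _ y _
      have h := hQ y
      rw [Finset.range_eq_Ico, Finset.sum_eq_sum_Ico_succ_bot (by omega)] at h
      have e : nflB (2 * 0 + 1) y = nfl 0 y := by
        funext s; simp only [nfl, nflB]; split_ifs <;> first | omega | rfl
      rw [e, ← h]
      congr 1
      unfold FF EE
      simp only [phi, lft, rgt]
      rw [if_neg (show ¬ (0 + 1 = n) by omega)]
      simp
    | succ K ih =>
      intro h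
      exact eqK_step hm q v hT hq (by omega) (ih (by omega))
  -- final equation
  have fin0 : ∀ σ, CC (m - 1) σ → FF n q v (m - 1) (nflB n σ) + EE n q v (n - 1) σ = 0 := by
    intro σ hσ
    have h := E (m - 1) (by omega) (nfl (n - 1) σ) ((CC_nfl (by omega) _).2 hσ)
    have hI : Finset.Ico (n - 1) n = {n - 1} := by
      ext t; simp only [Finset.mem_Ico, Finset.mem_singleton]; omega
    rw [show 2 * (m - 1) + 1 = n - 1 by omega, hI, Finset.sum_singleton, nfl_self] at h
    have e : nflB (n - 1) (nfl (n - 1) σ) = nflB n σ := by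
      funext s; simp only [nfl, nflB]; split_ifs <;> first | omega | simp
    rw [e] at h
    exact h
  have base : ∀ σ, CC (m - 1) σ → v σ = 0 := by
    have key : ∀ σ, CC (m - 1) σ → σ (n - 1) = σ 0 →
        phi q (m - 1) (nflB n σ) * v (nflB n σ) + q (n - 1) σ * v σ = 0 := by
      intro σ hσ h0
      have h := fin0 σ hσ
      have halt : σ (n - 2) = σ 0 := by
        rw [show n - 2 = 4 * ((m - 1) / 2) by omega]
        apply CC_alt
        rwa [show 2 * ((m - 1) / 2) = m - 1 by omega]
      unfold FF EE at h
      have b1 : n - 1 < n := by omega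
      have b2 : 0 < n := by omega
      have b3 : n - 2 < n := by omega
      have c1 : nflB n σ (n - 1) = nflB n σ 0 := by simp [nflB, b1, b2, h0]
      have c2 : nflB n σ (2 * (m - 1) + 1) = nflB n σ (2 * (m - 1)) := by
        rw [show 2 * (m - 1) + 1 = n - 1 by omega, show 2 * (m - 1) = n - 2 by omega]
        simp [nflB, b1, b3, h0, halt]
      have c3 : lft n (n - 1) = n - 2 := by
        unfold lft; rw [if_neg (by omega)]; omega
      have c4 : rgt n (n - 1) = 0 := by
        unfold rgt; rw [if_pos (by omega)]
      rw [if_pos ⟨c1, c2⟩, c3, c4, if_pos ⟨by rw [halt, h0], h0.symm⟩] at h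
      exact h
    intro σ hσ
    have halt : σ (n - 2) = σ 0 := by
      rw [show n - 2 = 4 * ((m - 1) / 2) by omega]
      apply CC_alt
      rwa [show 2 * ((m - 1) / 2) = m - 1 by omega]
    by_cases h0 : σ (n - 1) = σ 0
    · have k1 := key σ hσ h0
      have b1 : n - 1 < n := by omega
      have b2 : 0 < n := by omega
      have k2 := key (nflB n σ) ((CC_nflB (by omega) σ).2 hσ) (by simp [nflB, b1, b2, h0])
      rw [nflB_self] at k2
      have hp := phi_prod hm q Y hY hYne (m - 1) (by omega) σ
      have hy := hY (n - 1) (by omega) σ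
      have hd : (phi q (m - 1) σ * phi q (m - 1) (nflB n σ) - Y (n - 1)) * v σ = 0 := by
        rw [← hy]
        linear_combination phi q (m - 1) (nflB n σ) * k2 - q (n - 1) (nflB n σ) * k1
      refine (mul_eq_zero.1 hd).resolve_left fun h => hdet ?_
      rw [show m - 1 + 1 = m by omega] at hp
      rw [← hp]
      conv_lhs => rw [show m = m - 1 + 1 by omega]
      rw [Finset.prod_range_succ, show 2 * (m - 1) + 1 = n - 1 by omega]
      linear_combination - (∏ j ∈ Finset.range (m - 1), Y (2 * j + 1)) * h
    · apply hT
      refine ⟨m - 1, by omega, hσ, ?_, ?_⟩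
      · have c4 : rgt n (2 * (m - 1) + 1) = 0 := by
          unfold rgt; rw [if_pos (by omega)]
        rw [c4, show 2 * (m - 1) = n - 2 by omega, halt]
      · rw [show 2 * (m - 1) + 1 = n - 1 by omega, show 2 * (m - 1) = n - 2 by omega, halt]
        exact h0
  have desc : ∀ d, d + 1 ≤ m → ∀ σ, CC (m - 1 - d) σ → v σ = 0 := by
    intro d
    induction d with
    | zero => intro _ σ; exact base σ
    | succ d ih =>
      intro hd σ hσ
      obtain ⟨K, hK⟩ : ∃ K, K = m - 1 - (d + 1) := ⟨_, rfl⟩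
      have ih' := ih (by omega)
      rw [show m - 1 - d = K + 1 by omega] at ih'
      rw [← hK] at hσ
      by_cases g1 : σ (2 * K) = σ (2 * K + 2)
      · by_cases g2 : σ (2 * K + 1) = σ (2 * K)
        · have hs := star hm q v hT (K := K) (by omega) (E K (by omega)) σ hσ g2 g1.symm
          have v1 : v (nflB (2 * K + 1) (nfl (2 * K + 1) σ)) = 0 := by
            apply ih'
            rw [CC_succ]
            refine ⟨by rw [CC_nflB (by omega), CC_nfl (by omega)]; exact hσ, ?_⟩
            simp [nflB, nfl, g1]
          have v2 : v (nfl (2 * K + 2) (nfl (2 * K + 1) σ)) = 0 := by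
            apply ih'
            rw [CC_succ]
            refine ⟨by rw [CC_nfl (by omega), CC_nfl (by omega)]; exact hσ, ?_⟩
            simp [nfl, g1]
          unfold FF EE at hs
          rw [v1, v2] at hs
          simp only [mul_zero, ite_self, neg_zero, sub_zero] at hs
          exact (mul_eq_zero.1 hs).resolve_left (hq _ (by omega) (by omega) (by omega) _)
        · apply hT
          refine ⟨K, by omega, hσ, ?_, g2⟩
          have c4 : rgt n (2 * K + 1) = 2 * K + 2 := by
            unfold rgt; rw [if_neg (by omega)]
          rw [c4, g1]
      · exact ih' σ (CC_succ.2 ⟨hσ, g1⟩)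
  exact desc (m - 1) (by omega) z (fun s hs => by omega)

end elim2

section appl
variable {n : ℕ} [NeZero n]

def res (n : ℕ) [NeZero n] (o : ℕ) (z : ℕ → Bool) : St n := fun i => z ((i - nn n o).val)
def ext' (o : ℕ) (x : St n) : ℕ → Bool := fun t => x (nn n (o + t))

theorem exists_off (o : ℕ) (i : Fin n) : ∃ t < n, i = nn n (o + t) := by
  refine ⟨(i - nn n o).val, Fin.isLt _, ?_⟩
  rw [← nn_add, nn_coe]; abel

theorem off_inj (o : ℕ) {s t : ℕ} (hs : s < n) (ht : t < n) : nn n (o + s) = nn n (o + t) ↔ s = t := by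
  rw [← nn_add, ← nn_add, add_right_inj, nn_eq_of_lt hs ht]

theorem res_off (o : ℕ) (z : ℕ → Bool) {t : ℕ} (ht : t < n) : res n o z (nn n (o + t)) = z t := by
  unfold res
  rw [← nn_add, add_sub_cancel_left, nn_of_lt ht]

theorem st_ext (o : ℕ) {x y : St n} (h : ∀ t < n, x (nn n (o + t)) = y (nn n (o + t))) : x = y := by
  funext i
  obtain ⟨t, ht, rfl⟩ := exists_off o i
  exact h t ht

theorem res_ext (o : ℕ) (x : St n) : res n o (ext' o x) = x :=
  st_ext o fun t ht => by rw [res_off o _ ht]; rfl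

theorem ext_res (o : ℕ) (z : ℕ → Bool) {t : ℕ} (ht : t < n) : ext' o (res n o z) t = z t :=
  res_off o z ht

theorem res_nfl (o : ℕ) (z : ℕ → Bool) {t : ℕ} (ht : t < n) :
    res n o (nfl t z) = fl (nn n (o + t)) (res n o z) :=
  st_ext o fun s hs => by
    rw [res_off o _ hs]
    by_cases h : s = t
    · subst h; rw [fl_same, res_off o _ hs]; simp [nfl]
    · rw [fl_ne (fun g => h ((off_inj o hs ht).1 g)), res_off o _ hs]; simp [nfl, h]

theorem res_nflB (o : ℕ) (z : ℕ → Bool) : res n o (nflB n z) = cpl (res n o z) :=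
  st_ext o fun s hs => by
    rw [res_off o _ hs]; unfold cpl; rw [res_off o _ hs]; simp [nflB, hs]

theorem off_rgt (o : ℕ) {t : ℕ} (ht : t < n) : nn n (o + t) + 1 = nn n (o + rgt n t) := by
  unfold rgt
  rw [nn_succ]
  split_ifs with h
  · rw [show o + t + 1 = o + n by omega, nn_add_self, add_zero]
  · rw [add_assoc]

theorem rgt_lt {t : ℕ} (ht : t < n) : rgt n t < n := by
  unfold rgt; split_ifs <;> omega

theorem lft_lt {t : ℕ} (ht : t < n) : lft n t < n := by
  unfold lft; split_ifs <;> omega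

theorem off_lft (o : ℕ) {t : ℕ} (ht : t < n) : nn n (o + t) - 1 = nn n (o + lft n t) := by
  rw [sub_eq_iff_eq_add, off_rgt o (lft_lt ht)]
  congr 2
  unfold lft rgt; split_ifs <;> omega

theorem IsTgt_congr (hn2 : n % 2 = 0) {x y : ℕ → Bool} (h : ∀ t < n, x t = y t)
    (hx : IsTgt n x) : IsTgt n y := by
  obtain ⟨s, hs, h1, h2, h3⟩ := hx
  refine ⟨s, hs, ?_, ?_, ?_⟩
  · intro u hu
    rw [← h _ (by omega), ← h _ (by omega)]
    exact h1 u hu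
  · rw [← h _ (by omega), ← h _ (rgt_lt hs)]; exact h2
  · rw [← h _ (by omega), ← h _ (by omega)]; exact h3

def Pv (n s : ℕ) (x : ℕ → Bool) : Prop := CC s x ∧ x (2 * s) = x (rgt n (2 * s + 1))

theorem Pv_unique (hn2 : n % 2 = 0) {s s' : ℕ} (hs : 2 * s + 1 < n) (hs' : 2 * s' + 1 < n)
    {x : ℕ → Bool} (h : Pv n s x) (h' : Pv n s' x) : s = s' := by
  have aux : ∀ {s s' : ℕ}, 2 * s + 1 < n → 2 * s' + 1 < n → Pv n s x → Pv n s' x → ¬ s < s' := by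
    intro s s' hs hs' h h' hlt
    apply h'.1 s hlt
    rw [h.2]
    unfold rgt; rw [if_neg (by omega)]
  have a1 := aux hs hs' h h'
  have a2 := aux hs' hs h' h
  omega

theorem Pv_congr (hn2 : n % 2 = 0) {s t : ℕ} (hs : 2 * s + 1 < n) (ht : t % 2 = 1) {x y : ℕ → Bool}
    (h : ∀ u < n, u ≠ t → x u = y u) (hx : Pv n s x) : Pv n s y := by
  refine ⟨fun u hu => ?_, ?_⟩
  · rw [← h _ (by omega) (by omega), ← h _ (by omega) (by omega)]
    exact hx.1 u hu
  · rw [← h _ (by omega) (by omega), ← h _ (rgt_lt hs)]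
    · exact hx.2
    · unfold rgt; split_ifs <;> omega

theorem card_nonTgt (hn2 : n % 2 = 0) (hn : 4 ≤ n) (o : ℕ) :
    2 ^ (n - 1) ≤ (Finset.univ.filter fun x : St n => ¬ IsTgt n (ext' o x)).card := by
  have hle : (Finset.univ.filter fun x : St n => IsTgt n (ext' o x)).card ≤
      (Finset.univ.filter fun x : St n => ¬ IsTgt n (ext' o x)).card := by
    have hex : ∀ x : St n, ∃ s, IsTgt n (ext' o x) → 2 * s + 1 < n ∧ Pv n s (ext' o x) ∧
        ext' o x (2 * s + 1) ≠ ext' o x (2 * s) := by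
      intro x
      by_cases hx : IsTgt n (ext' o x)
      · obtain ⟨s, hs, h1, h2, h3⟩ := hx
        exact ⟨s, fun _ => ⟨hs, ⟨h1, h2⟩, h3⟩⟩
      · exact ⟨0, fun h => absurd h hx⟩
    choose S hS using hex
    have hcg : ∀ x : St n, IsTgt n (ext' o x) → ∀ u < n, u ≠ 2 * S x + 1 →
        ext' o x u = ext' o (fl (nn n (o + (2 * S x + 1))) x) u := by
      intro x hx u hu hne
      unfold ext'
      rw [fl_ne]
      intro g
      exact hne ((off_inj o hu (hS x hx).1).1 g)
    have hPv : ∀ x : St n, IsTgt n (ext' o x) →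
        Pv n (S x) (ext' o (fl (nn n (o + (2 * S x + 1))) x)) := by
      intro x hx
      exact Pv_congr hn2 (hS x hx).1 (by omega) (hcg x hx) (hS x hx).2.1
    refine Finset.card_le_card_of_injOn (fun x => fl (nn n (o + (2 * S x + 1))) x) ?_ ?_
    · intro x hx
      have hx : IsTgt n (ext' o x) := by simpa using hx
      suffices ¬ IsTgt n (ext' o (fl (nn n (o + (2 * S x + 1))) x)) by simpa using this
      rintro ⟨s, hs, h1, h2, h3⟩
      have e : s = S x := Pv_unique hn2 hs (hS x hx).1 ⟨h1, h2⟩ (hPv x hx)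
      subst e
      apply h3
      rw [← hcg x hx (2 * S x) (by omega) (by omega)]
      have h4 := (hS x hx).2.2
      have : ext' o (fl (nn n (o + (2 * S x + 1))) x) (2 * S x + 1) = !ext' o x (2 * S x + 1) := by
        unfold ext'; rw [fl_same]
      rw [this]
      revert h4
      generalize ext' o x (2 * S x + 1) = a
      generalize ext' o x (2 * S x) = b
      revert a b; decide
    · intro x hx y hy hxy
      have hx : IsTgt n (ext' o x) := by simpa using hx
      have hy : IsTgt n (ext' o y) := by simpa using hy
      have hxy : fl (nn n (o + (2 * S x + 1))) x = fl (nn n (o + (2 * S y + 1))) y := hxy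
      have h1 := hPv x hx
      rw [hxy] at h1
      have e : S x = S y := Pv_unique hn2 (hS x hx).1 (hS y hy).1 h1 (hPv y hy)
      rw [e] at hxy
      have := congrArg (fl (nn n (o + (2 * S y + 1)))) hxy
      rwa [fl_fl, fl_fl] at this
  have htot := Finset.card_filter_add_card_filter_not (s := (Finset.univ : Finset (St n)))
    (fun x : St n => IsTgt n (ext' o x))
  have hc : (Finset.univ : Finset (St n)).card = 2 ^ n := by simp [St]
  have h2 : 2 ^ n = 2 * 2 ^ (n - 1) := by
    rw [← pow_succ']; congr 1; omega
  omega

variable {k : Type*} [Field k]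

theorem rank_ge_aux {m : ℕ} (hm : n = 2 * m) (hm2 : m % 2 = 1) (hn : 4 ≤ n) (a c : Fin n → k) (o : ℕ)
    (Y : ℕ → k) (hYd : ∀ t, Y t = (-1) ^ (nn n (o + t)).val * (a (nn n (o + t)) * c (nn n (o + t))))
    (hYne : ∀ t < n, t % 2 = 1 → Y t ≠ 0)
    (hdet : ∏ j ∈ Finset.range m, Y (2 * j + 1) ≠ ∏ j ∈ Finset.range m, Y (2 * j)) :
    2 ^ (n - 1) ≤ (QM a c).rank := by
  refine (card_nonTgt (by omega) hn o).trans (le_rank_of_inj' _ _ ?_)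
  intro v hv hQ
  have h := elim_main (k := k) hm hm2 hn (fun t z => qq a c (nn n (o + t)) (res n o z))
    (fun z => v (res n o z)) ?_ Y ?_ hYne hdet ?_
  · funext x
    have := h (ext' o x)
    rw [res_ext] at this
    exact this
  · intro x hx
    apply hv
    rw [not_not]
    exact IsTgt_congr (by omega) (fun t ht => (ext_res o x ht).symm) hx
  · intro t ht z
    rw [res_nflB, qq_compl, hYd]
  · intro y
    have h := congrFun hQ (res n o y)
    rw [QM_mulVec, ← Equiv.sum_comp (Equiv.addLeft (nn n o)), sum_nn] at h
    rw [Pi.zero_apply] at h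
    rw [← h]
    refine Finset.sum_congr rfl fun t ht => ?_
    rw [Finset.mem_range] at ht
    unfold EE
    have e0 : (Equiv.addLeft (nn n o)) (nn n t) = nn n (o + t) := nn_add o t
    have hs : src (nn n (o + t)) (res n o (nfl t y)) ↔
        nfl t y (lft n t) = nfl t y t ∧ nfl t y (rgt n t) = nfl t y t := by
      unfold src
      rw [off_lft o ht, off_rgt o ht, res_off o _ ht, res_off o _ (lft_lt ht),
        res_off o _ (rgt_lt ht)]
    simp only [e0, ← res_nfl o y ht, hs]

theorem neg_prod {m : ℕ} (hm2 : m % 2 = 1) (f : ℕ → k) :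
    ∏ j ∈ Finset.range m, (- f j) = - ∏ j ∈ Finset.range m, f j := by
  rw [Finset.prod_neg, Finset.card_range, Odd.neg_one_pow (Nat.odd_iff.2 hm2)]
  ring

theorem rank_ge {m : ℕ} (hm : n = 2 * m) (hm2 : m % 2 = 1) (hn : 4 ≤ n) (a c : Fin n → k)
    (hp : ∏ j ∈ Finset.range m, (a (nn n (2 * j)) * c (nn n (2 * j))) +
      ∏ j ∈ Finset.range m, (a (nn n (2 * j + 1)) * c (nn n (2 * j + 1))) ≠ 0) :
    2 ^ (n - 1) ≤ (QM a c).rank := by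
  by_cases ho : ∏ j ∈ Finset.range m, (a (nn n (2 * j + 1)) * c (nn n (2 * j + 1))) = 0
  · -- offset one
    have he : ∏ j ∈ Finset.range m, (a (nn n (2 * j)) * c (nn n (2 * j))) ≠ 0 := by
      intro h; apply hp; rw [h, ho, add_zero]
    obtain ⟨Y, hYd⟩ : ∃ Y : ℕ → k, ∀ t, Y t = (-1) ^ (nn n (1 + t)).val *
      (a (nn n (1 + t)) * c (nn n (1 + t))) := ⟨_, fun _ => rfl⟩
    have hYo : ∀ j, Y (2 * j + 1) = a (nn n (2 * (j + 1))) * c (nn n (2 * (j + 1))) := by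
      intro j
      rw [hYd, show 1 + (2 * j + 1) = 2 * (j + 1) by ring, Even.neg_one_pow, one_mul]
      rw [nn_val, Nat.even_iff, hm, Nat.mul_mod_mul_left]; omega
    have hYe : ∀ j < m, Y (2 * j) = - (a (nn n (2 * j + 1)) * c (nn n (2 * j + 1))) := by
      intro j hj
      rw [hYd, show 1 + (2 * j) = 2 * j + 1 by ring, Odd.neg_one_pow]
      · ring
      rw [nn_of_lt (by omega), Nat.odd_iff]; omega
    have hPo : ∏ j ∈ Finset.range m, Y (2 * j + 1) =
        ∏ j ∈ Finset.range m, (a (nn n (2 * j)) * c (nn n (2 * j))) := by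
      rw [Finset.prod_congr rfl fun j _ => hYo j]
      obtain ⟨l, rfl⟩ : ∃ l, m = l + 1 := ⟨m - 1, by omega⟩
      rw [Finset.prod_range_succ, Finset.prod_range_succ' _ l, ← hm, nn_self, mul_zero, nn_zero]
    have hPe : ∏ j ∈ Finset.range m, Y (2 * j) =
        - ∏ j ∈ Finset.range m, (a (nn n (2 * j + 1)) * c (nn n (2 * j + 1))) := by
      rw [← neg_prod hm2]
      exact Finset.prod_congr rfl fun j hj => hYe j (Finset.mem_range.1 hj)
    refine rank_ge_aux hm hm2 hn a c 1 Y hYd ?_ ?_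
    · intro t ht ht2
      rw [← hPo, Finset.prod_ne_zero_iff] at he
      have := he (t / 2) (Finset.mem_range.2 (by omega))
      rwa [show 2 * (t / 2) + 1 = t by omega] at this
    · rw [hPo, hPe]
      intro h; apply hp; rw [h]; ring
  · obtain ⟨Y, hYd⟩ : ∃ Y : ℕ → k, ∀ t, Y t = (-1) ^ (nn n (0 + t)).val *
      (a (nn n (0 + t)) * c (nn n (0 + t))) := ⟨_, fun _ => rfl⟩
    have hYe : ∀ j < m, Y (2 * j) = a (nn n (2 * j)) * c (nn n (2 * j)) := by
      intro j hj
      rw [hYd, zero_add, Even.neg_one_pow, one_mul]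
      rw [nn_of_lt (by omega), Nat.even_iff]; omega
    have hYo : ∀ j < m, Y (2 * j + 1) = - (a (nn n (2 * j + 1)) * c (nn n (2 * j + 1))) := by
      intro j hj
      rw [hYd, zero_add, Odd.neg_one_pow]
      · ring
      rw [nn_of_lt (by omega), Nat.odd_iff]; omega
    have hPe : ∏ j ∈ Finset.range m, Y (2 * j) =
        ∏ j ∈ Finset.range m, (a (nn n (2 * j)) * c (nn n (2 * j))) :=
      Finset.prod_congr rfl fun j hj => hYe j (Finset.mem_range.1 hj)
    have hPo : ∏ j ∈ Finset.range m, Y (2 * j + 1) =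
        - ∏ j ∈ Finset.range m, (a (nn n (2 * j + 1)) * c (nn n (2 * j + 1))) := by
      rw [← neg_prod hm2]
      exact Finset.prod_congr rfl fun j hj => hYo j (Finset.mem_range.1 hj)
    refine rank_ge_aux hm hm2 hn a c 0 Y hYd ?_ ?_
    · intro t ht ht2
      rw [← neg_eq_zero, ← hPo] at ho
      have := Finset.prod_ne_zero_iff.1 ho (t / 2) (Finset.mem_range.2 (by omega))
      rwa [show 2 * (t / 2) + 1 = t by omega] at this
    · rw [hPo, hPe]
      intro h; apply hp; rw [← h]; ring

end appl

theorem filt_prod {n m : ℕ} [NeZero n] (hm : n = 2 * m) {k : Type*} [Field k] (e : ℕ) (he : e < 2)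
    (f : Fin n → k) :
    ∏ i ∈ Finset.univ.filter (fun i : Fin n => i.val % 2 = e), f i =
      ∏ j ∈ Finset.range m, f (nn n (2 * j + e)) := by
  symm
  refine Finset.prod_nbij' (fun j => nn n (2 * j + e)) (fun i => i.val / 2) ?_ ?_ ?_ ?_ ?_
  · intro j hj
    rw [Finset.mem_range] at hj
    rw [Finset.mem_filter, nn_of_lt (by omega)]
    exact ⟨Finset.mem_univ _, by omega⟩
  · intro i _
    have := i.2
    rw [Finset.mem_range]; omega
  · intro j hj
    rw [Finset.mem_range] at hj
    show (nn n (2 * j + e)).val / 2 = j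
    rw [nn_of_lt (by omega)]; omega
  · intro i hi
    have hi := (Finset.mem_filter.1 hi).2
    show nn n (2 * (i.val / 2) + e) = i
    rw [show 2 * (i.val / 2) + e = i.val by omega, nn_coe]
  · intro j _; rfl

theorem prod_cc {n : ℕ} (k : Type*) [Field k] (X : Finset (Finset (Fin n))) (s : Finset ℕ)
    (g : ℕ → Fin n) : ∏ j ∈ s, cc k X (g j) = 0 ∨ ∏ j ∈ s, cc k X (g j) = 1 := by
  by_cases h : ∃ j ∈ s, {g j} ∈ X
  · obtain ⟨j, hj, h⟩ := h
    left
    exact Finset.prod_eq_zero hj (by simp [cc, h])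
  · right
    push Not at h
    exact Finset.prod_eq_one fun j hj => by simp [cc, h j hj]

theorem img_id {n : ℕ} [NeZero n] {k : Type*} (V : Set (Fin n → k)) :
    (fun a => fun i => a ((Equiv.refl (Fin n)) i)) '' V = V := by
  simp

/-- If `G_X` is the `n`-cycle and `V_X` is not all of `k^n`, then `n ≡ 2 (mod 4)` and,
up to an automorphism of the cycle (a rotation possibly composed with a reflection),
`V_X` is `V(χ_1χ_3⋯χ_{n-1} + χ_2χ_4⋯χ_n)` or `V(χ_2χ_4⋯χ_n)`.  With `0`-indexing, the
odd-labelled product is over coordinates of even index and the even-labelled product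
over coordinates of odd index. -/
theorem cycle_gcd_interesting_support (k : Type*) [Field k] [IsAlgClosed k]
    (n : ℕ) [NeZero n] (hn : 3 ≤ n)
    (X : Finset (Finset (Fin n))) (hX : IsGenPattern n X)
    (hcyc : GcdGraphIsCycle n X)
    (hne : supportVariety k X ≠ Set.univ) :
    n % 4 = 2 ∧
      ∃ π : Equiv.Perm (Fin n),
        (∃ c : Fin n, (∀ i, π i = c + i) ∨ (∀ i, π i = c - i)) ∧
        ((fun a => fun i => a (π i)) '' supportVariety k X =
            {a : Fin n → k |
              (∏ i ∈ Finset.univ.filter fun i : Fin n => i.val % 2 = 0, a i) +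
                (∏ i ∈ Finset.univ.filter fun i : Fin n => i.val % 2 = 1, a i) = 0} ∨
          (fun a => fun i => a (π i)) '' supportVariety k X =
            {a : Fin n → k |
              (∏ i ∈ Finset.univ.filter fun i : Fin n => i.val % 2 = 1, a i) = 0}) := by
  by_cases h3 : n = 3
  · subst h3
    exact absurd (variety_three X hX hcyc) hne
  have hn4 : 4 ≤ n := by omega
  have h4 : n % 4 = 2 := by
    by_contra h
    apply hne
    rw [Set.eq_univ_iff_forall]
    intro a
    rw [mem_variety_iff hn4 hcyc]
    exact rank_lt_of_mod hn h a _
  refine ⟨h4, ?_⟩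
  obtain ⟨m, hm⟩ : ∃ m, n = 2 * m := ⟨n / 2, by omega⟩
  have hm2 : m % 2 = 1 := by omega
  have hV : ∀ a, a ∈ supportVariety k X ↔
      (∏ j ∈ Finset.range m, a (nn n (2 * j))) * (∏ j ∈ Finset.range m, cc k X (nn n (2 * j))) +
      (∏ j ∈ Finset.range m, a (nn n (2 * j + 1))) *
        (∏ j ∈ Finset.range m, cc k X (nn n (2 * j + 1))) = 0 := by
    intro a
    rw [mem_variety_iff hn4 hcyc, ← Finset.prod_mul_distrib, ← Finset.prod_mul_distrib]
    constructor
    · intro h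
      by_contra hp
      exact absurd (rank_ge hm hm2 hn4 a (cc k X) hp) (not_le.2 h)
    · intro h
      exact rank_lt_of_loop hm hm2 hn4 a (cc k X) h
  rcases prod_cc k X (Finset.range m) (fun j => nn n (2 * j)) with he | he <;>
    rcases prod_cc k X (Finset.range m) (fun j => nn n (2 * j + 1)) with ho | ho <;>
    simp only [he, ho, mul_zero, mul_one, add_zero, zero_add] at hV
  · exfalso
    apply hne
    rw [Set.eq_univ_iff_forall]
    intro a
    simp [hV]
  · refine ⟨Equiv.refl _, ⟨0, Or.inl fun i => by simp⟩, Or.inr ?_⟩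
    rw [img_id]
    ext a
    rw [hV, Set.mem_ofPred_eq, filt_prod hm 1 (by omega)]
  · refine ⟨Equiv.addLeft 1, ⟨1, Or.inl fun i => rfl⟩, Or.inr ?_⟩
    have hsh : ∀ b : Fin n → k, ∏ j ∈ Finset.range m, b ((Equiv.addLeft 1) (nn n (2 * j + 1))) =
        ∏ j ∈ Finset.range m, b (nn n (2 * j)) := by
      intro b
      have e : ∀ j, (Equiv.addLeft 1) (nn n (2 * j + 1)) = nn n (2 * (j + 1)) := by
        intro j
        show 1 + nn n (2 * j + 1) = _
        rw [add_comm (1 : Fin n), nn_succ]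
        rfl
      simp only [e]
      obtain ⟨l, rfl⟩ : ∃ l, m = l + 1 := ⟨m - 1, by omega⟩
      rw [Finset.prod_range_succ, Finset.prod_range_succ' _ l, ← hm, nn_self, mul_zero, nn_zero]
    ext a
    rw [Set.mem_ofPred_eq, filt_prod hm 1 (by omega)]
    constructor
    · rintro ⟨b, hb, rfl⟩
      rw [hV] at hb
      show ∏ j ∈ Finset.range m, b ((Equiv.addLeft 1) (nn n (2 * j + 1))) = 0
      rw [hsh, hb]
    · intro ha
      refine ⟨fun i => a ((Equiv.addLeft 1).symm i), ?_, ?_⟩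
      · rw [hV, ← hsh (fun i => a ((Equiv.addLeft 1).symm i))]
        simpa using ha
      · funext i
        simp
  · refine ⟨Equiv.refl _, ⟨0, Or.inl fun i => by simp⟩, Or.inl ?_⟩
    rw [img_id]
    ext a
    rw [hV, Set.mem_ofPred_eq, filt_prod hm 1 (by omega), filt_prod hm 0 (by omega)]
    simp only [add_zero]
end
end

section
/- Let a, b ≥ 1, set n = a + b + 3, and label the elements of [n] as p_1, p_2, p_3, g_1,…,g_a, h_1,…,h_b. Let DB(a,b) be the simple graph on these vertices with edges {p_1,p_2}, {p_2,p_3}, {p_1,g_i} for 1 ≤ i ≤ a, and {p_3,h_j} for 1 ≤ j ≤ b (the double broom), and let WT(a,b) be DB(a,b) together with the additional edge {p_1,p_3} (the whiskered triangle). Let k be an algebraically closed field and X a generating pattern on [n] with G_X = DB(a,b) or G_X = WT(a,b). If the singleton {p_2} is not in X, then V_X = {α ∈ k^n : α_{g_i} = 0 for all 1 ≤ i ≤ a} ∪ {α ∈ k^n : α_{h_j} = 0 for all 1 ≤ j ≤ b}; if {p_2} ∈ X, then V_X = k^n. -/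
open scoped Classical

noncomputable section

/-- One orientation of the adjacency of the double broom `DB(a,b)` on values
`0,1,2` (the path `p₁,p₂,p₃`), `3,…,a+2` (the brooms `g_1,…,g_a` at `p₁`), and
`a+3,…,a+b+2` (the brooms `h_1,…,h_b` at `p₃`). -/
def dbAdjHalf (a : ℕ) (i j : ℕ) : Prop :=
  (i = 0 ∧ j = 1) ∨ (i = 1 ∧ j = 2) ∨ (i = 0 ∧ 3 ≤ j ∧ j ≤ a + 2) ∨ (i = 2 ∧ a + 3 ≤ j)

/-- Adjacency of the double broom `DB(a,b)`. -/
def DBAdj (a b : ℕ) (i j : Fin (a + b + 3)) : Prop :=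
  dbAdjHalf a i.val j.val ∨ dbAdjHalf a j.val i.val

/-- Adjacency of the whiskered triangle `WT(a,b)`: `DB(a,b)` plus the edge `{p₁,p₃}`. -/
def WTAdj (a b : ℕ) (i j : Fin (a + b + 3)) : Prop :=
  DBAdj a b i j ∨ (i.val = 0 ∧ j.val = 2) ∨ (i.val = 2 ∧ j.val = 0)


def flipI {n : ℕ} (i : Fin n) (r : Finset (Fin n)) : Finset (Fin n) :=
  if i ∈ r then r.erase i else insert i r

lemma mem_flipI {n : ℕ} (i j : Fin n) (r : Finset (Fin n)) :
    j ∈ flipI i r ↔ (if j = i then i ∉ r else j ∈ r) := by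
  unfold flipI
  by_cases h : i ∈ r <;> by_cases hj : j = i <;> simp [h, hj]

lemma flipI_flipI {n : ℕ} (i : Fin n) (r : Finset (Fin n)) : flipI i (flipI i r) = r := by
  ext j
  by_cases hj : j = i <;> simp [mem_flipI, hj]

lemma flipI_comm {n : ℕ} (i j : Fin n) (r : Finset (Fin n)) :
    flipI i (flipI j r) = flipI j (flipI i r) := by
  ext l
  simp only [mem_flipI]
  by_cases h1 : l = i <;> by_cases h2 : l = j <;> by_cases h3 : i = j <;> simp_all

def condI {n : ℕ} (X : Finset (Finset (Fin n))) (i : Fin n) (r : Finset (Fin n)) : Prop :=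
  ∀ τ ∈ X, i ∈ τ → if i ∈ r then ∀ l ∈ τ, l ∈ r → l = i else ∃ l ∈ τ, l ∈ r

lemma condI_not_mem {n : ℕ} (X : Finset (Finset (Fin n))) (i : Fin n) (r : Finset (Fin n))
    (h : i ∉ r) : condI X i r ↔ DiffEdge X r i := by
  unfold condI DiffEdge
  simp [h, Finset.Nonempty]

lemma condI_mem {n : ℕ} (X : Finset (Finset (Fin n))) (i : Fin n) (r : Finset (Fin n))
    (h : i ∈ r) : condI X i r ↔ HomEdge X (r.erase i) i := by
  unfold condI HomEdge Nbhd GcdAdj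
  simp only [h, if_true]
  simp
  grind

def wI {n : ℕ} {k : Type*} [Field k] (X : Finset (Finset (Fin n))) (a : Fin n → k)
    (i : Fin n) (r : Finset (Fin n)) : k :=
  if condI X i r then (edgeSign r i : k) * (if i ∈ r then a i else 1) else 0

lemma edgeSign_congr {n : ℕ} (i : Fin n) (r s : Finset (Fin n))
    (h : ∀ j, j ≠ i → (j ∈ r ↔ j ∈ s)) : edgeSign r i = edgeSign s i := by
  unfold edgeSign
  congr 2
  ext j
  simp only [Finset.mem_filter]
  constructor
  · rintro ⟨h1, h2⟩; exact ⟨(h j h2.ne).1 h1, h2⟩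
  · rintro ⟨h1, h2⟩; exact ⟨(h j h2.ne).2 h1, h2⟩

lemma taylor_eq_s4 {n : ℕ} {k : Type*} [Field k] (X : Finset (Finset (Fin n))) (a : Fin n → k)
    (r c : Finset (Fin n)) :
    taylorMatrixAt X a r c = ∑ i, if c = flipI i r then wI X a i r else 0 := by
  unfold taylorMatrixAt
  rw [← Finset.sum_add_distrib]
  apply Finset.sum_congr rfl
  intro i _
  unfold wI
  by_cases hi : i ∈ r
  · have h1 : ¬ DiffEdge X r i := fun h => h.1 hi
    have e : flipI i r = r.erase i := by simp [flipI, hi]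
    rw [if_neg (fun h => h1 h.2), zero_add, e]
    by_cases hc : c = r.erase i
    · subst hc
      have e2 : edgeSign (r.erase i) i = edgeSign r i :=
        edgeSign_congr _ _ _ (fun j hj => by simp [hj])
      simp [hi, condI_mem, e2]
    · rw [if_neg, if_neg hc]
      rintro ⟨h2, h3⟩
      apply hc
      rw [h2, Finset.erase_insert h3.1]
  · have e : flipI i r = insert i r := by simp [flipI, hi]
    have hne : ¬ (r = insert i c ∧ HomEdge X c i) := fun h => hi (by rw [h.1]; simp)
    rw [e, if_neg hne, add_zero]
    by_cases hc : c = insert i r <;> simp [hc, hi, condI_not_mem]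

lemma sign_flip {n : ℕ} (i j : Fin n) (r : Finset (Fin n)) (hij : i ≠ j) :
    edgeSign (flipI i r) j = (if i < j then -1 else 1) * edgeSign r j := by
  by_cases h : i < j
  · by_cases hi : i ∈ r
    · have : (r.filter fun l => l < j) = insert i ((flipI i r).filter fun l => l < j) := by
        ext l; simp only [Finset.mem_filter, Finset.mem_insert, mem_flipI]
        by_cases hl : l = i <;> simp [hl, hi, h]
      unfold edgeSign
      rw [this, Finset.card_insert_of_notMem (by simp [mem_flipI, hi])]
      simp [h, pow_succ]
    · have : ((flipI i r).filter fun l => l < j) = insert i (r.filter fun l => l < j) := by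
        ext l; simp only [Finset.mem_filter, Finset.mem_insert, mem_flipI]
        by_cases hl : l = i <;> simp [hl, hi, h]
      unfold edgeSign
      rw [this, Finset.card_insert_of_notMem (by simp [hi])]
      simp [h, pow_succ]
  · have : ((flipI i r).filter fun l => l < j) = (r.filter fun l => l < j) := by
      ext l; simp only [Finset.mem_filter, mem_flipI]
      by_cases hl : l = i <;> simp [hl, h]
    unfold edgeSign
    rw [this]; simp [h]

lemma cond_swap {n : ℕ} (X : Finset (Finset (Fin n))) (i j : Fin n) (hij : i ≠ j)
    (r : Finset (Fin n)) (h1 : condI X i r) (h2 : condI X j (flipI i r)) :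
    condI X j r ∧ condI X i (flipI j r) := by
  have hji := hij.symm
  unfold condI at *
  simp only [mem_flipI] at *
  simp only [hij, hji, if_false] at *
  by_cases hi : i ∈ r <;> by_cases hj : j ∈ r <;> simp only [hi, hj, if_true, if_false] at h1 h2 ⊢ <;>
    constructor <;> intro τ hτ hm <;> grind

lemma cond_self {n : ℕ} (X : Finset (Finset (Fin n))) (i : Fin n) (hi : ∃ τ ∈ X, i ∈ τ)
    (r : Finset (Fin n)) (h1 : condI X i r) (h2 : condI X i (flipI i r)) : False := by
  unfold condI at *
  obtain ⟨τ, hτ, hm⟩ := hi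
  have h1 := h1 τ hτ hm
  have h2 := h2 τ hτ hm
  simp only [mem_flipI] at h2
  grind

lemma w_swap {n : ℕ} {k : Type*} [Field k] (X : Finset (Finset (Fin n))) (a : Fin n → k)
    (i j : Fin n) (hij : i ≠ j) (r : Finset (Fin n)) :
    wI X a i r * wI X a j (flipI i r) + wI X a j r * wI X a i (flipI j r) = 0 := by
  unfold wI
  have hji := hij.symm
  by_cases h : condI X i r ∧ condI X j (flipI i r)
  · have h' := cond_swap X i j hij r h.1 h.2
    rw [if_pos h.1, if_pos h.2, if_pos h'.1, if_pos h'.2, sign_flip _ _ _ hij, sign_flip _ _ _ hji]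
    simp only [mem_flipI, hij, hji, if_false]
    rcases lt_or_gt_of_ne hij with hl | hl
    · simp only [hl, hl.not_gt, if_true, if_false]; push_cast; ring
    · simp only [hl, hl.not_gt, if_true, if_false]; push_cast; ring
  · have h' : ¬ (condI X j r ∧ condI X i (flipI j r)) := fun h' =>
      h (cond_swap X j i hji r h'.1 h'.2)
    rcases not_and_or.1 h with h | h <;> rcases not_and_or.1 h' with h' | h' <;> simp [h, h']

lemma taylor_sq {n : ℕ} {k : Type*} [Field k] (X : Finset (Finset (Fin n))) (a : Fin n → k)
    (hX : ∀ i, ∃ τ ∈ X, i ∈ τ) : taylorMatrixAt X a * taylorMatrixAt X a = 0 := by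
  ext r c
  rw [Matrix.mul_apply]
  have : ∀ m, taylorMatrixAt X a r m * taylorMatrixAt X a m c =
      ∑ i, if m = flipI i r then wI X a i r * taylorMatrixAt X a m c else 0 := by
    intro m
    rw [taylor_eq_s4 X a r m, Finset.sum_mul]
    exact Finset.sum_congr rfl fun i _ => by split_ifs <;> simp
  simp_rw [this]
  rw [Finset.sum_comm]
  simp only [Finset.sum_ite_eq', Finset.mem_univ, if_true, Finset.sum_ite_eq]
  simp_rw [taylor_eq_s4 X a _ c, Finset.mul_sum]
  rw [← Finset.sum_product']
  refine Finset.sum_involution (fun p _ => (p.2, p.1)) ?_ ?_ ?_ ?_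
  · rintro ⟨i, j⟩ _
    dsimp only
    rw [flipI_comm i j]
    by_cases hij : i = j
    · subst hij
      have : wI X a i r * wI X a i (flipI i r) = 0 := by
        unfold wI
        by_cases h1 : condI X i r
        · rw [if_neg (c := condI X i (flipI i r)) (fun h2 => cond_self X i (hX i) r h1 h2), mul_zero]
        · simp [h1]
      split_ifs <;> simp [this]
    · split_ifs
      · exact w_swap X a i j hij r
      · simp
  · rintro ⟨i, j⟩ _ hne h
    apply hne
    have hij : i = j := by simpa using congrArg Prod.snd h
    subst hij
    have : wI X a i r * wI X a i (flipI i r) = 0 := by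
      unfold wI
      by_cases h1 : condI X i r
      · rw [if_neg (c := condI X i (flipI i r)) (fun h2 => cond_self X i (hX i) r h1 h2), mul_zero]
      · simp [h1]
    dsimp only
    split_ifs <;> simp [this]
  · simp
  · simp

lemma isolated {n : ℕ} {k : Type*} [Field k] (X : Finset (Finset (Fin n))) (a : Fin n → k)
    (hn : 1 ≤ n) (hX : ∀ i, ∃ τ ∈ X, i ∈ τ) (v : Finset (Fin n))
    (h1 : ∀ i ∈ v, ¬ HomEdge X (v.erase i) i ∨ a i = 0)
    (h2 : ∀ i ∈ v, ¬ DiffEdge X (v.erase i) i)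
    (h3 : ∀ i ∉ v, ¬ HomEdge X v i ∨ a i = 0)
    (h4 : ∀ i ∉ v, ¬ DiffEdge X v i) : a ∈ supportVariety k X := by
  have hrow : ∀ c, taylorMatrixAt X a v c = 0 := by
    intro c
    rw [taylor_eq_s4]
    refine Finset.sum_eq_zero fun i _ => ?_
    have : wI X a i v = 0 := by
      unfold wI
      by_cases hi : i ∈ v
      · rw [condI_mem _ _ _ hi]
        rcases h1 i hi with h | h <;> simp [h, hi]
      · rw [condI_not_mem _ _ _ hi]
        simp [h4 i hi]
    simp [this]
  have hcol : ∀ r, taylorMatrixAt X a r v = 0 := by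
    intro r
    rw [taylor_eq_s4]
    refine Finset.sum_eq_zero fun i _ => ?_
    by_cases hv : v = flipI i r
    · have hr : r = flipI i v := by rw [hv, flipI_flipI]
      have : wI X a i r = 0 := by
        unfold wI
        by_cases hi : i ∈ v
        · have hr' : r = v.erase i := by rw [hr]; simp [flipI, hi]
          rw [condI_not_mem _ _ _ (by rw [hr']; simp), hr']
          simp [h2 i hi]
        · have hr' : r = insert i v := by rw [hr]; simp [flipI, hi]
          rw [condI_mem _ _ _ (by rw [hr']; simp), hr', Finset.erase_insert hi]
          rcases h3 i hi with h | h <;> simp [h, hi]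
      simp [this]
    · simp [hv]
  intro f g hf hg
  by_contra hdet
  set T := taylorMatrixAt X a with hT
  have hsq : T * T = 0 := taylor_sq X a hX
  have hlt : LinearMap.range T.mulVecLin < LinearMap.ker T.mulVecLin := by
    refine lt_of_le_of_ne ?_ ?_
    · rintro _ ⟨x, rfl⟩
      simp [Matrix.mulVec_mulVec, hsq]
    · intro he
      have hk : Pi.single v (1 : k) ∈ LinearMap.ker T.mulVecLin := by
        simp only [LinearMap.mem_ker, Matrix.mulVecLin_apply, Matrix.mulVec_single_one]
        ext r; exact hcol r
      rw [← he] at hk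
      obtain ⟨x, hx⟩ := hk
      have := congrFun hx v
      simp [Matrix.mulVec, dotProduct, hrow] at this
  have h5 := Submodule.finrank_lt_finrank_of_lt hlt
  have h6 := LinearMap.finrank_range_add_finrank_ker T.mulVecLin
  have h7 : 2 ^ (n - 1) ≤ T.rank := by
    have e1 : (T.submatrix f g).rank = 2 ^ (n - 1) := by
      rw [Matrix.rank_of_isUnit _ ((Matrix.isUnit_iff_isUnit_det _).2 (isUnit_iff_ne_zero.2 hdet))]
      simp
    rw [← e1]
    exact Matrix.rank_submatrix_le _ _ _
  simp only [Module.finrank_fintype_fun_eq_card, Fintype.card_finset, Fintype.card_fin] at h6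
  have h8 : 2 ^ n = 2 * 2 ^ (n - 1) := by
    rw [← pow_succ']; congr 1; omega
  unfold Matrix.rank at h7
  omega

lemma full_of {n : ℕ} {k : Type*} [Field k] (X : Finset (Finset (Fin n))) (a : Fin n → k)
    (S : Finset (Finset (Fin n))) (hS : S.card = 2 ^ (n - 1))
    (m : Finset (Fin n) → Finset (Fin n)) (hm : ∀ s ∈ S, ∀ t ∈ S, m s = m t → s = t)
    (lvl : Finset (Fin n) → ℕ)
    (hd : ∀ s ∈ S, taylorMatrixAt X a (m s) s ≠ 0)
    (ho : ∀ s ∈ S, ∀ t ∈ S, s ≠ t → taylorMatrixAt X a (m s) t ≠ 0 → lvl s < lvl t) :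
    a ∉ supportVariety k X := by
  intro ha
  let e : Fin (2 ^ (n - 1)) ≃ S := (S.equivFinOfCardEq hS).symm
  have hinj : Function.Injective (fun i => (e i : Finset (Fin n))) :=
    Subtype.val_injective.comp e.injective
  have h0 := ha (fun i => m (e i)) (fun i => e i)
    (fun i j hij => hinj (hm _ (e i).2 _ (e j).2 hij)) hinj
  obtain ⟨v, hv, hv0⟩ := Matrix.exists_mulVec_eq_zero_iff.2 h0
  obtain ⟨i0, hi0⟩ := Function.ne_iff.1 hv
  obtain ⟨i, hi, hmax⟩ := Finset.exists_max_image (Finset.univ.filter fun i => v i ≠ 0)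
    (fun i => lvl (e i)) ⟨i0, by simpa using hi0⟩
  have := congrFun hv0 i
  rw [Matrix.mulVec, dotProduct, Finset.sum_eq_single i] at this
  · simp only [Finset.mem_filter, Finset.mem_univ, true_and] at hi
    exact mul_ne_zero (hd _ (e i).2) hi this
  · intro j _ hji
    by_contra hne
    have hvj : v j ≠ 0 := right_ne_zero_of_mul hne
    have h1 := ho _ (e i).2 _ (e j).2 (fun h => hji (hinj h).symm) (left_ne_zero_of_mul hne)
    have h2 := hmax j (by simpa using hvj)
    omega
  · simp

lemma flipI_inj {n : ℕ} (i j : Fin n) (r : Finset (Fin n)) (h : flipI i r = flipI j r) : i = j := by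
  by_contra hij
  have h1 := mem_flipI i i r
  have h2 := mem_flipI j i r
  rw [h] at h1
  simp [hij] at h1 h2
  tauto

set_option maxHeartbeats 4000000 in
lemma comb {n : ℕ} (p1 p2 p3 g h : Fin n) (e12 : p1 ≠ p2) (e13 : p1 ≠ p3) (e1g : p1 ≠ g)
    (e1h : p1 ≠ h) (e23 : p2 ≠ p3) (e2g : p2 ≠ g) (e2h : p2 ≠ h) (e3g : p3 ≠ g) (e3h : p3 ≠ h)
    (egh : g ≠ h) (s t M : Finset (Fin n)) (i q : Fin n)
    (hq : q = if p1 ∈ s then (if p3 ∈ s then p2 else h) else g) (hiq : i ≠ q)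
    (t1 : p1 ∈ t ↔ if i = p1 then i ∉ M else p1 ∈ M)
    (t2 : p2 ∈ t ↔ if i = p2 then i ∉ M else p2 ∈ M)
    (t3 : p3 ∈ t ↔ if i = p3 then i ∉ M else p3 ∈ M)
    (tg : g ∈ t ↔ if i = g then i ∉ M else g ∈ M)
    (th : h ∈ t ↔ if i = h then i ∉ M else h ∈ M)
    (s1 : p1 ∈ M ↔ if p1 = q then q ∉ s else p1 ∈ s)
    (s2 : p2 ∈ M ↔ if p2 = q then q ∉ s else p2 ∈ s)
    (s3 : p3 ∈ M ↔ if p3 = q then q ∉ s else p3 ∈ s)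
    (sg : g ∈ M ↔ if g = q then q ∉ s else g ∈ s)
    (sh : h ∈ M ↔ if h = q then q ∉ s else h ∈ s)
    (hs : (p1 ∉ s ∧ g ∉ s) ∨ (p1 ∈ s ∧ p3 ∉ s ∧ h ∉ s) ∨ (p1 ∈ s ∧ p3 ∈ s ∧ p2 ∈ s))
    (ht : (p1 ∉ t ∧ g ∉ t) ∨ (p1 ∈ t ∧ p3 ∉ t ∧ h ∉ t) ∨ (p1 ∈ t ∧ p3 ∈ t ∧ p2 ∈ t))
    (key : (i ∉ M ∧ ((i = p1 ∧ p2 ∈ M ∧ g ∈ M) ∨ (i = p2 ∧ p1 ∈ M ∧ p3 ∈ M) ∨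
      (i = p3 ∧ p2 ∈ M ∧ h ∈ M))) ∨ (i ∈ M ∧ (i = p1 → p2 ∉ M ∧ g ∉ M) ∧
        (i = p2 → p1 ∉ M ∧ p3 ∉ M) ∧
      (i = p3 → p2 ∉ M ∧ h ∉ M) ∧ (i = g → p1 ∉ M) ∧ (i = h → p3 ∉ M))) :
    (if p1 ∈ s then (if p3 ∈ s then 3 else if p2 ∈ s then 2 else 4)
      else (if p2 ∈ s then (if p3 ∈ s then 2 else 1) else if p3 ∈ s then 4 else 5)) <
    (if p1 ∈ t then (if p3 ∈ t then 3 else if p2 ∈ t then 2 else 4)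
      else (if p2 ∈ t then (if p3 ∈ t then 2 else 1) else if p3 ∈ t then 4 else 5)) := by
  have e21 := Ne.symm e12
  have e31 := Ne.symm e13
  have eg1 := Ne.symm e1g
  have eh1 := Ne.symm e1h
  have e32 := Ne.symm e23
  have eg2 := Ne.symm e2g
  have eh2 := Ne.symm e2h
  have eg3 := Ne.symm e3g
  have eh3 := Ne.symm e3h
  have ehg := Ne.symm egh
  by_cases a1 : p1 ∈ s <;> by_cases a3 : p3 ∈ s <;> by_cases a2 : p2 ∈ s <;>
    simp only [a1, a2, a3, if_true, if_false] at hq hs ⊢ <;> simp only [hq] at * <;>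
    by_cases i1 : i = p1 <;> by_cases i2 : i = p2 <;> by_cases i3 : i = p3 <;>
    by_cases i4 : i = g <;> by_cases i5 : i = h <;>
    simp_all

lemma full_case {n : ℕ} {k : Type*} [Field k] (X : Finset (Finset (Fin n))) (α : Fin n → k)
    (p1 p2 p3 g h : Fin n) (hn : 1 ≤ n)
    (hd : [p1, p2, p3, g, h].Nodup) (hg0 : α g ≠ 0) (hh0 : α h ≠ 0)
    (hD : ∀ r i, DiffEdge X r i → (i = p1 ∧ p2 ∈ r ∧ g ∈ r) ∨ (i = p2 ∧ p1 ∈ r ∧ p3 ∈ r) ∨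
      (i = p3 ∧ p2 ∈ r ∧ h ∈ r))
    (hH : ∀ c i, HomEdge X c i → (i = p1 → p2 ∉ c ∧ g ∉ c) ∧ (i = p2 → p1 ∉ c ∧ p3 ∉ c) ∧
      (i = p3 → p2 ∉ c ∧ h ∉ c) ∧ (i = g → p1 ∉ c) ∧ (i = h → p3 ∉ c))
    (hg : ∀ c, p1 ∉ c → g ∉ c → HomEdge X c g)
    (hh : ∀ c, p3 ∉ c → h ∉ c → HomEdge X c h)
    (h2 : ∀ r, p1 ∈ r → p3 ∈ r → p2 ∉ r → DiffEdge X r p2) :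
    α ∉ supportVariety k X := by
  simp only [List.nodup_cons, List.mem_cons, List.not_mem_nil, or_false, not_or] at hd
  obtain ⟨⟨e12, e13, e1g, e1h⟩, ⟨e23, e2g, e2h⟩, ⟨e3g, e3h⟩, egh, -⟩ := hd
  have e21 := Ne.symm e12
  have e31 := Ne.symm e13
  have eg1 := Ne.symm e1g
  have eh1 := Ne.symm e1h
  have e32 := Ne.symm e23
  have eg2 := Ne.symm e2g
  have eh2 := Ne.symm e2h
  have eg3 := Ne.symm e3g
  have eh3 := Ne.symm e3h
  have ehg := Ne.symm egh
  let q : Finset (Fin n) → Fin n := fun s => if p1 ∈ s then (if p3 ∈ s then p2 else h) else g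
  let m : Finset (Fin n) → Finset (Fin n) := fun s => flipI (q s) s
  let P : Finset (Fin n) → Prop := fun s =>
    (p1 ∉ s ∧ g ∉ s) ∨ (p1 ∈ s ∧ p3 ∉ s ∧ h ∉ s) ∨ (p1 ∈ s ∧ p3 ∈ s ∧ p2 ∈ s)
  have hm1 : ∀ s, p1 ∈ m s ↔ p1 ∈ s := by
    intro s
    simp only [m, q, mem_flipI]
    split_ifs <;> simp_all
  have hm3 : ∀ s, p3 ∈ m s ↔ p3 ∈ s := by
    intro s
    simp only [m, q, mem_flipI]
    split_ifs <;> simp_all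
  have hqm : ∀ s, q (m s) = q s := by
    intro s
    simp only [q, hm1, hm3]
  have hmm : ∀ s, m (m s) = s := by
    intro s
    show flipI (q (m s)) (flipI (q s) s) = s
    rw [hqm, flipI_flipI]
  have hPm : ∀ s, P (m s) ↔ ¬ P s := by
    intro s
    simp only [P, hm1, hm3]
    simp only [m, q, mem_flipI]
    by_cases a1 : p1 ∈ s <;> by_cases a3 : p3 ∈ s <;> simp [a1, a3]
  refine full_of X α (Finset.univ.filter P) ?_ m ?_
    (fun σ => if p1 ∈ σ then (if p3 ∈ σ then 3 else if p2 ∈ σ then 2 else 4)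
      else (if p2 ∈ σ then (if p3 ∈ σ then 2 else 1) else if p3 ∈ σ then 4 else 5)) ?_ ?_
  · have c1 : (Finset.univ.filter P).card = (Finset.univ.filter fun s => ¬ P s).card := by
      refine Finset.card_nbij' m m ?_ ?_ ?_ ?_
      · intro s hs
        simp at hs ⊢
        rw [hPm]; simpa using hs
      · intro s hs
        simp at hs ⊢
        rw [hPm]; simpa using hs
      · intro s _; exact hmm s
      · intro s _; exact hmm s
    have c2 := Finset.card_filter_add_card_filter_not (s := (Finset.univ : Finset (Finset (Fin n)))) P
    rw [← c1] at c2
    simp only [Finset.card_univ, Fintype.card_finset, Fintype.card_fin] at c2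
    have h8 : 2 ^ n = 2 * 2 ^ (n - 1) := by
      rw [← pow_succ']; congr 1; omega
    omega
  · intro s _ t _ hst
    rw [← hmm s, hst, hmm]
  · intro s hs
    simp only [Finset.mem_filter, Finset.mem_univ, true_and] at hs
    rw [taylor_eq_s4, Finset.sum_eq_single (q s)]
    · rw [if_pos (flipI_flipI _ _).symm]
      have sg : ((edgeSign (m s) (q s) : ℤ) : k) ≠ 0 := by
        unfold edgeSign; push_cast; simp
      unfold wI
      rw [if_pos]
      · refine mul_ne_zero sg ?_
        simp only [P] at hs
        simp only [m, mem_flipI, q]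
        clear hD hH hg hh h2 hm1 hm3 hqm hmm hPm sg
        by_cases a1 : p1 ∈ s <;> by_cases a3 : p3 ∈ s <;> simp [a1, a3] at hs ⊢ <;> simp [hs, hg0, hh0]
      · rcases hs with ⟨a1, a2⟩ | ⟨a1, a2, a3⟩ | ⟨a1, a2, a3⟩
        · have hq : q s = g := by simp [q, a1]
          have hms : m s = insert g s := by simp [m, hq, flipI, a2]
          rw [hq, hms, condI_mem _ _ _ (by simp), Finset.erase_insert a2]
          exact hg s a1 a2
        · have hq : q s = h := by simp [q, a1, a2]
          have hms : m s = insert h s := by simp [m, hq, flipI, a3]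
          rw [hq, hms, condI_mem _ _ _ (by simp), Finset.erase_insert a3]
          exact hh s a2 a3
        · have hq : q s = p2 := by simp [q, a1, a2]
          have hms : m s = s.erase p2 := by simp [m, hq, flipI, a3]
          rw [hq, hms, condI_not_mem _ _ _ (by simp)]
          exact h2 _ (by simp [e12, a1]) (by simp [e32, a2]) (by simp)
    · intro i _ hi
      rw [if_neg]
      intro he
      apply hi
      refine flipI_inj i (q s) (m s) ?_
      rw [← he]; simp only [m]; rw [flipI_flipI]
    · simp
  · intro s hs t ht hst hT
    simp only [Finset.mem_filter, Finset.mem_univ, true_and] at hs ht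
    rw [taylor_eq_s4] at hT
    obtain ⟨i, -, hi⟩ := Finset.exists_ne_zero_of_sum_ne_zero hT
    have hte : t = flipI i (m s) := by
      by_contra hne; simp [hne] at hi
    have hc : condI X i (m s) := by
      by_contra hne; simp [wI, hne] at hi
    have hiq : i ≠ q s := by
      rintro rfl
      apply hst
      rw [hte]; simp only [m]; rw [flipI_flipI]
    have hmt : ∀ x, x ∈ t ↔ if i = x then i ∉ m s else x ∈ m s := by
      intro x; rw [hte, mem_flipI]; simp only [eq_comm]
    have hms : ∀ x, x ∈ m s ↔ if x = q s then q s ∉ s else x ∈ s := by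
      intro x; simp only [m, mem_flipI]
    have t1 := hmt p1
    have t2 := hmt p2
    have t3 := hmt p3
    have tg := hmt g
    have th := hmt h
    have s1 := hms p1
    have s2 := hms p2
    have s3 := hms p3
    have sg := hms g
    have sh := hms h
    have key : (i ∉ m s ∧ ((i = p1 ∧ p2 ∈ m s ∧ g ∈ m s) ∨ (i = p2 ∧ p1 ∈ m s ∧ p3 ∈ m s) ∨
      (i = p3 ∧ p2 ∈ m s ∧ h ∈ m s))) ∨ (i ∈ m s ∧ (i = p1 → p2 ∉ m s ∧ g ∉ m s) ∧
        (i = p2 → p1 ∉ m s ∧ p3 ∉ m s) ∧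
      (i = p3 → p2 ∉ m s ∧ h ∉ m s) ∧ (i = g → p1 ∉ m s) ∧ (i = h → p3 ∉ m s)) := by
      by_cases him : i ∈ m s
      · right
        rw [condI_mem _ _ _ him] at hc
        have := hH _ _ hc
        refine ⟨him, ?_⟩
        obtain ⟨b1, b2, b3, b4, b5⟩ := this
        simp only [Finset.mem_erase, not_and] at b1 b2 b3 b4 b5
        refine ⟨fun e => ⟨(b1 e).1 ?_, (b1 e).2 ?_⟩, fun e => ⟨(b2 e).1 ?_, (b2 e).2 ?_⟩,
          fun e => ⟨(b3 e).1 ?_, (b3 e).2 ?_⟩, fun e => b4 e ?_, fun e => b5 e ?_⟩ <;>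
          (rw [e]; assumption)
      · left
        rw [condI_not_mem _ _ _ him] at hc
        exact ⟨him, hD _ _ hc⟩
    have hq : q s = if p1 ∈ s then (if p3 ∈ s then p2 else h) else g := rfl
    simp only [P] at hs ht
    exact comb p1 p2 p3 g h e12 e13 e1g e1h e23 e2g e2h e3g e3h egh s t (m s) i (q s) hq hiq
      t1 t2 t3 tg th s1 s2 s3 sg sh hs ht key

lemma main_aux (a b : ℕ) (ha : 1 ≤ a) (hb : 1 ≤ b)
    (k : Type*) [Field k]
    (X : Finset (Finset (Fin (a + b + 3)))) (hX : IsGenPattern (a + b + 3) X)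
    (p1 p2 p3 g h : Fin (a + b + 3)) (hp1 : p1.val = 0) (hp2 : p2.val = 1) (hp3 : p3.val = 2)
    (hg : 3 ≤ g.val ∧ g.val ≤ a + 2) (hh : a + 3 ≤ h.val)
    (hA1 : ∀ i j, GcdAdj X i j → WTAdj a b i j) (hA2 : ∀ i j, DBAdj a b i j → GcdAdj X i j)
    (α : Fin (a + b + 3) → k) :
    ({p2} ∈ X → α ∈ supportVariety k X) ∧
    ({p2} ∉ X → (∀ i : Fin (a + b + 3), 3 ≤ i.val → i.val ≤ a + 2 → α i = 0) →
      α ∈ supportVariety k X) ∧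
    ({p2} ∉ X → (∀ i : Fin (a + b + 3), a + 3 ≤ i.val → α i = 0) →
      α ∈ supportVariety k X) ∧
    ({p2} ∉ X → α g ≠ 0 → α h ≠ 0 → α ∉ supportVariety k X) := by
  have hex : ∀ i, ∃ τ ∈ X, i ∈ τ := by
    intro i
    by_cases hi : i = p1
    · obtain ⟨σ, h1, h2, -⟩ := hX.2 i p2 (by rw [hi]; intro h; rw [h] at hp1; omega)
      exact ⟨σ, h1, h2⟩
    · obtain ⟨σ, h1, h2, -⟩ := hX.2 i p1 hi
      exact ⟨σ, h1, h2⟩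
  have adjm : ∀ σ ∈ X, ∀ i ∈ σ, ∀ j ∈ σ, j ≠ i → WTAdj a b i j := fun σ hσ i hi j hj hij =>
    hA1 i j ⟨hij.symm, σ, hσ, hi, hj⟩
  have single : ∀ i : Fin (a + b + 3), 3 ≤ i.val → {i} ∈ X := by
    intro i hi
    have : ∃ p, i ≠ p ∧ ∀ j, WTAdj a b i j → j = p := by
      by_cases hi2 : i.val ≤ a + 2
      · refine ⟨p1, by intro h; rw [h] at hi; omega, fun j hj => ?_⟩
        unfold WTAdj DBAdj dbAdjHalf at hj
        apply Fin.ext; omega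
      · refine ⟨p3, by intro h; rw [h] at hi; omega, fun j hj => ?_⟩
        unfold WTAdj DBAdj dbAdjHalf at hj
        apply Fin.ext; omega
    obtain ⟨p, hp, hall⟩ := this
    obtain ⟨σ, h1, h2, h3⟩ := hX.2 i p hp
    have : σ = {i} := by
      rw [Finset.eq_singleton_iff_unique_mem]
      refine ⟨h2, fun j hj => ?_⟩
      by_contra hji
      exact h3 (hall j (adjm σ h1 i h2 j hj hji) ▸ hj)
    exact this ▸ h1
  have nd : ∀ r i, 3 ≤ i.val → ¬ DiffEdge X r i := by
    intro r i hi hd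
    obtain ⟨x, hx⟩ := hd.2 _ (single i hi) (by simp)
    simp at hx
    exact hd.1 (hx.1 ▸ hx.2)
  have dpair : ∀ r i j, {i, j} ∈ X → DiffEdge X r i → j ∈ r := by
    intro r i j hij hd
    obtain ⟨x, hx⟩ := hd.2 _ hij (by simp)
    simp at hx
    rcases hx.1 with h | h
    · exact absurd (h ▸ hx.2) hd.1
    · exact h ▸ hx.2
  have hom : ∀ c i j, HomEdge X c i → DBAdj a b j i → j ∉ c := by
    intro c i j hh hd hj
    apply hh.2
    simp only [Nbhd, Finset.mem_filter, Finset.mem_univ, true_and]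
    exact ⟨j, hj, hA2 _ _ hd⟩
  have pg : ∀ g : Fin (a + b + 3), 3 ≤ g.val → g.val ≤ a + 2 → {p1, g} ∈ X := by
    intro g h1 h2
    obtain ⟨hne, σ, hσ, m1, m2⟩ := hA2 p1 g (by unfold DBAdj dbAdjHalf; omega)
    have : σ = {p1, g} := by
      ext j
      simp only [Finset.mem_insert, Finset.mem_singleton]
      constructor
      · intro hj
        by_cases hjg : j = g
        · exact Or.inr hjg
        · left
          have := adjm σ hσ g m2 j hj hjg
          unfold WTAdj DBAdj dbAdjHalf at this
          apply Fin.ext; omega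
      · rintro (rfl | rfl) <;> assumption
    exact this ▸ hσ
  have ph : ∀ g : Fin (a + b + 3), a + 3 ≤ g.val → {p3, g} ∈ X := by
    intro g h1
    obtain ⟨hne, σ, hσ, m1, m2⟩ := hA2 p3 g (by unfold DBAdj dbAdjHalf; omega)
    have : σ = {p3, g} := by
      ext j
      simp only [Finset.mem_insert, Finset.mem_singleton]
      constructor
      · intro hj
        by_cases hjg : j = g
        · exact Or.inr hjg
        · left
          have := adjm σ hσ g m2 j hj hjg
          unfold WTAdj DBAdj dbAdjHalf at this
          apply Fin.ext; omega
      · rintro (rfl | rfl) <;> assumption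
    exact this ▸ hσ
  have adj2 : ∀ j, WTAdj a b p2 j → j = p1 ∨ j = p3 := by
    intro j hj
    unfold WTAdj DBAdj dbAdjHalf at hj
    rw [Fin.ext_iff, Fin.ext_iff]; omega
  have e12 : p1 ≠ p2 := by rw [Ne, Fin.ext_iff]; omega
  have e13 : p1 ≠ p3 := by rw [Ne, Fin.ext_iff]; omega
  have e23 : p2 ≠ p3 := by rw [Ne, Fin.ext_iff]; omega
  have e1g : p1 ≠ g := by rw [Ne, Fin.ext_iff]; omega
  have e2g : p2 ≠ g := by rw [Ne, Fin.ext_iff]; omega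
  have e3g : p3 ≠ g := by rw [Ne, Fin.ext_iff]; omega
  have e1h : p1 ≠ h := by rw [Ne, Fin.ext_iff]; omega
  have e2h : p2 ≠ h := by rw [Ne, Fin.ext_iff]; omega
  have e3h : p3 ≠ h := by rw [Ne, Fin.ext_iff]; omega
  have egh : g ≠ h := by rw [Ne, Fin.ext_iff]; omega
  have cases5 : ∀ i : Fin (a + b + 3), i = p1 ∨ i = p2 ∨ i = p3 ∨ (3 ≤ i.val ∧ i.val ≤ a + 2) ∨
      a + 3 ≤ i.val := by
    intro i
    simp only [Fin.ext_iff]; omega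
  have dbp : ∀ i j, dbAdjHalf a i.val j.val → DBAdj a b i j := fun i j h => Or.inl h
  have d12 : DBAdj a b p1 p2 := by unfold DBAdj dbAdjHalf; omega
  have d21 : DBAdj a b p2 p1 := by unfold DBAdj dbAdjHalf; omega
  have d23 : DBAdj a b p2 p3 := by unfold DBAdj dbAdjHalf; omega
  have d32 : DBAdj a b p3 p2 := by unfold DBAdj dbAdjHalf; omega
  have dg : ∀ i : Fin (a + b + 3), 3 ≤ i.val ∧ i.val ≤ a + 2 → DBAdj a b p1 i := by
    intro i hi; unfold DBAdj dbAdjHalf; omega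
  have dh : ∀ i : Fin (a + b + 3), a + 3 ≤ i.val → DBAdj a b p3 i := by
    intro i hi; unfold DBAdj dbAdjHalf; omega
  have dg' : ∀ i : Fin (a + b + 3), 3 ≤ i.val ∧ i.val ≤ a + 2 → DBAdj a b i p1 := by
    intro i hi; unfold DBAdj dbAdjHalf; omega
  have dh' : ∀ i : Fin (a + b + 3), a + 3 ≤ i.val → DBAdj a b i p3 := by
    intro i hi; unfold DBAdj dbAdjHalf; omega
  have d1g : ∀ r, DiffEdge X r p1 → g ∈ r := fun r => dpair r _ _ (pg g hg.1 hg.2)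
  have d3h : ∀ r, DiffEdge X r p3 → h ∈ r := fun r => dpair r _ _ (ph h hh)
  have pair1 : {p2} ∉ X → {p2, p1} ∈ X := by
    intro hp
    obtain ⟨σ, h1, h2, h3⟩ := hX.2 p2 p3 e23
    have hsub : ∀ j ∈ σ, j ≠ p2 → j = p1 := fun j hj hne => by
      rcases adj2 j (adjm σ h1 p2 h2 j hj hne) with h | h
      · exact h
      · exact absurd (h ▸ hj) h3
    have hm : p1 ∈ σ := by
      by_contra hm
      apply hp
      have : σ = {p2} := by
        rw [Finset.eq_singleton_iff_unique_mem]
        refine ⟨h2, fun j hj => ?_⟩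
        by_contra hne
        exact hm (hsub j hj hne ▸ hj)
      exact this ▸ h1
    have : σ = {p2, p1} := by
      ext j
      simp only [Finset.mem_insert, Finset.mem_singleton]
      constructor
      · intro hj
        by_cases hne : j = p2
        · exact Or.inl hne
        · exact Or.inr (hsub j hj hne)
      · rintro (rfl | rfl) <;> assumption
    exact this ▸ h1
  have pair3 : {p2} ∉ X → {p2, p3} ∈ X := by
    intro hp
    obtain ⟨σ, h1, h2, h3⟩ := hX.2 p2 p1 e12.symm
    have hsub : ∀ j ∈ σ, j ≠ p2 → j = p3 := fun j hj hne => by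
      rcases adj2 j (adjm σ h1 p2 h2 j hj hne) with h | h
      · exact absurd (h ▸ hj) h3
      · exact h
    have hm : p3 ∈ σ := by
      by_contra hm
      apply hp
      have : σ = {p2} := by
        rw [Finset.eq_singleton_iff_unique_mem]
        refine ⟨h2, fun j hj => ?_⟩
        by_contra hne
        exact hm (hsub j hj hne ▸ hj)
      exact this ▸ h1
    have : σ = {p2, p3} := by
      ext j
      simp only [Finset.mem_insert, Finset.mem_singleton]
      constructor
      · intro hj
        by_cases hne : j = p2
        · exact Or.inl hne
        · exact Or.inr (hsub j hj hne)
      · rintro (rfl | rfl) <;> assumption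
    exact this ▸ h1
  refine ⟨fun hp => ?_, fun hp h0 => ?_, fun hp h0 => ?_, fun hp hg0 hh0 => ?_⟩
  · refine isolated X α (by omega) hex {p1, p2, p3} ?_ ?_ ?_ ?_
    · intro i hi
      left
      intro hE
      simp only [Finset.mem_insert, Finset.mem_singleton] at hi
      rcases hi with rfl | rfl | rfl
      · exact hom _ _ p2 hE d21 (by simp [e12.symm])
      · exact hom _ _ p1 hE d12 (by simp [e12])
      · exact hom _ _ p2 hE d23 (by simp [e23])
    · intro i hi hE
      simp only [Finset.mem_insert, Finset.mem_singleton] at hi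
      rcases hi with rfl | rfl | rfl
      · have := d1g _ hE
        simp [e1g.symm, e2g.symm, e3g.symm] at this
      · obtain ⟨x, hx⟩ := hE.2 _ hp (by simp)
        simp at hx
      · have := d3h _ hE
        simp [e1h.symm, e2h.symm, e3h.symm] at this
    · intro i hi
      left
      intro hE
      rcases cases5 i with rfl | rfl | rfl | h5 | h5
      · simp at hi
      · simp at hi
      · simp at hi
      · exact hom _ _ p1 hE (dg i h5) (by simp)
      · exact hom _ _ p3 hE (dh i h5) (by simp)
    · intro i hi
      refine nd _ i ?_
      rcases cases5 i with rfl | rfl | rfl | h5 | h5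
      · simp at hi
      · simp at hi
      · simp at hi
      · omega
      · omega
  · have q1 : ∀ r, DiffEdge X r p1 → p2 ∈ r := fun r =>
      dpair r _ _ (by rw [Finset.pair_comm]; exact pair1 hp)
    have q3 : ∀ r, DiffEdge X r p3 → p2 ∈ r := fun r =>
      dpair r _ _ (by rw [Finset.pair_comm]; exact pair3 hp)
    have q21 : ∀ r, DiffEdge X r p2 → p1 ∈ r := fun r => dpair r _ _ (pair1 hp)
    refine isolated X α (by omega) hex {p3, g, h} ?_ ?_ ?_ ?_
    · intro i hi
      simp only [Finset.mem_insert, Finset.mem_singleton] at hi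
      rcases hi with rfl | rfl | rfl
      · exact Or.inl fun hE => hom _ _ h hE (dh' h hh) (by simp [e3h.symm])
      · exact Or.inr (h0 _ hg.1 hg.2)
      · exact Or.inl fun hE => hom _ _ p3 hE (dh _ hh) (by simp [e3h])
    · intro i hi hE
      simp only [Finset.mem_insert, Finset.mem_singleton] at hi
      rcases hi with rfl | rfl | rfl
      · have := q3 _ hE
        simp [e23, e2g, e2h] at this
      · exact nd _ _ hg.1 hE
      · exact nd _ _ (by omega) hE
    · intro i hi
      rcases cases5 i with rfl | rfl | rfl | h5 | h5
      · exact Or.inl fun hE => hom _ _ g hE (dg' g hg) (by simp)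
      · exact Or.inl fun hE => hom _ _ p3 hE d32 (by simp)
      · simp at hi
      · exact Or.inr (h0 _ h5.1 h5.2)
      · exact Or.inl fun hE => hom _ _ p3 hE (dh i h5) (by simp)
    · intro i hi hE
      rcases cases5 i with rfl | rfl | rfl | h5 | h5
      · have := q1 _ hE
        simp [e23, e2g, e2h] at this
      · have := q21 _ hE
        simp [e13, e1g, e1h] at this
      · simp at hi
      · exact nd _ _ h5.1 hE
      · exact nd _ _ (by omega) hE
  · have q1 : ∀ r, DiffEdge X r p1 → p2 ∈ r := fun r =>
      dpair r _ _ (by rw [Finset.pair_comm]; exact pair1 hp)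
    have q3 : ∀ r, DiffEdge X r p3 → p2 ∈ r := fun r =>
      dpair r _ _ (by rw [Finset.pair_comm]; exact pair3 hp)
    have q23 : ∀ r, DiffEdge X r p2 → p3 ∈ r := fun r => dpair r _ _ (pair3 hp)
    refine isolated X α (by omega) hex {p1, g, h} ?_ ?_ ?_ ?_
    · intro i hi
      simp only [Finset.mem_insert, Finset.mem_singleton] at hi
      rcases hi with rfl | rfl | rfl
      · exact Or.inl fun hE => hom _ _ g hE (dg' g hg) (by simp [e1g.symm])
      · exact Or.inl fun hE => hom _ _ p1 hE (dg _ hg) (by simp [e1g])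
      · exact Or.inr (h0 _ hh)
    · intro i hi hE
      simp only [Finset.mem_insert, Finset.mem_singleton] at hi
      rcases hi with rfl | rfl | rfl
      · have := q1 _ hE
        simp [e12.symm, e2g, e2h] at this
      · exact nd _ _ hg.1 hE
      · exact nd _ _ (by omega) hE
    · intro i hi
      rcases cases5 i with rfl | rfl | rfl | h5 | h5
      · simp at hi
      · exact Or.inl fun hE => hom _ _ p1 hE d12 (by simp)
      · exact Or.inl fun hE => hom _ _ h hE (dh' h hh) (by simp)
      · exact Or.inl fun hE => hom _ _ p1 hE (dg i h5) (by simp)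
      · exact Or.inr (h0 _ h5)
    · intro i hi hE
      rcases cases5 i with rfl | rfl | rfl | h5 | h5
      · simp at hi
      · have := q23 _ hE
        simp [e13.symm, e3g, e3h] at this
      · have := q3 _ hE
        simp [e12.symm, e2g, e2h] at this
      · exact nd _ _ h5.1 hE
      · exact nd _ _ (by omega) hE
  · have q1 : ∀ r, DiffEdge X r p1 → p2 ∈ r := fun r =>
      dpair r _ _ (by rw [Finset.pair_comm]; exact pair1 hp)
    have q3 : ∀ r, DiffEdge X r p3 → p2 ∈ r := fun r =>
      dpair r _ _ (by rw [Finset.pair_comm]; exact pair3 hp)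
    have q21 : ∀ r, DiffEdge X r p2 → p1 ∈ r := fun r => dpair r _ _ (pair1 hp)
    have q23 : ∀ r, DiffEdge X r p2 → p3 ∈ r := fun r => dpair r _ _ (pair3 hp)
    refine full_case X α p1 p2 p3 g h (by omega) ?_ hg0 hh0 ?_ ?_ ?_ ?_ ?_
    · simp [e12, e13, e23, e1g, e2g, e3g, e1h, e2h, e3h, egh]
    · intro r i hE
      rcases cases5 i with rfl | rfl | rfl | h5 | h5
      · exact Or.inl ⟨rfl, q1 _ hE, d1g _ hE⟩
      · exact Or.inr (Or.inl ⟨rfl, q21 _ hE, q23 _ hE⟩)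
      · exact Or.inr (Or.inr ⟨rfl, q3 _ hE, d3h _ hE⟩)
      · exact absurd hE (nd _ _ h5.1)
      · exact absurd hE (nd _ _ (by omega))
    · intro c i hE
      refine ⟨?_, ?_, ?_, ?_, ?_⟩ <;> intro hi <;> rw [hi] at hE
      · exact ⟨hom _ _ _ hE d21, hom _ _ _ hE (dg' g hg)⟩
      · exact ⟨hom _ _ _ hE d12, hom _ _ _ hE d32⟩
      · exact ⟨hom _ _ _ hE d23, hom _ _ _ hE (dh' h hh)⟩
      · exact hom _ _ _ hE (dg g hg)
      · exact hom _ _ _ hE (dh h hh)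
    · intro c h1 h2
      refine ⟨h2, ?_⟩
      simp only [Nbhd, Finset.mem_filter, Finset.mem_univ, true_and]
      rintro ⟨j, hj, hadj⟩
      have := hA1 _ _ hadj
      have hj1 : j = p1 := by
        unfold WTAdj DBAdj dbAdjHalf at this
        apply Fin.ext; omega
      exact h1 (hj1 ▸ hj)
    · intro c h1 h2
      refine ⟨h2, ?_⟩
      simp only [Nbhd, Finset.mem_filter, Finset.mem_univ, true_and]
      rintro ⟨j, hj, hadj⟩
      have := hA1 _ _ hadj
      have hj1 : j = p3 := by
        unfold WTAdj DBAdj dbAdjHalf at this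
        apply Fin.ext; omega
      exact h1 (hj1 ▸ hj)
    · intro r h1 h3 h2
      refine ⟨h2, fun τ hτ hm => ?_⟩
      have : ∃ j ∈ τ, j ≠ p2 := by
        by_contra hcon
        push Not at hcon
        apply hp
        have : τ = {p2} := by
          rw [Finset.eq_singleton_iff_unique_mem]
          exact ⟨hm, hcon⟩
        exact this ▸ hτ
      obtain ⟨j, hj, hne⟩ := this
      refine ⟨j, Finset.mem_inter.2 ⟨hj, ?_⟩⟩
      rcases adj2 j (adjm τ hτ p2 hm j hj hne) with h | h <;> rw [h] <;> assumption

theorem double_broom_whiskered_triangle_support (a b : ℕ) (ha : 1 ≤ a) (hb : 1 ≤ b)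
    (k : Type*) [Field k] [IsAlgClosed k]
    (X : Finset (Finset (Fin (a + b + 3)))) (hX : IsGenPattern (a + b + 3) X)
    (hG : (∀ i j, GcdAdj X i j ↔ DBAdj a b i j) ∨ (∀ i j, GcdAdj X i j ↔ WTAdj a b i j)) :
    (({(⟨1, by omega⟩ : Fin (a + b + 3))} : Finset (Fin (a + b + 3))) ∉ X →
      supportVariety k X =
        {α : Fin (a + b + 3) → k | ∀ i : Fin (a + b + 3),
            3 ≤ i.val → i.val ≤ a + 2 → α i = 0} ∪
          {α : Fin (a + b + 3) → k | ∀ i : Fin (a + b + 3), a + 3 ≤ i.val → α i = 0}) ∧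
    (({(⟨1, by omega⟩ : Fin (a + b + 3))} : Finset (Fin (a + b + 3))) ∈ X →
      supportVariety k X = Set.univ) := by
  have hA1 : ∀ i j, GcdAdj X i j → WTAdj a b i j := by
    intro i j h
    rcases hG with hG | hG
    · exact Or.inl ((hG i j).1 h)
    · exact (hG i j).1 h
  have hA2 : ∀ i j, DBAdj a b i j → GcdAdj X i j := by
    intro i j h
    rcases hG with hG | hG
    · exact (hG i j).2 h
    · exact (hG i j).2 (Or.inl h)
  have key := fun (g h : Fin (a + b + 3)) hg hh α => main_aux a b ha hb k X hX ⟨0, by omega⟩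
    ⟨1, by omega⟩ ⟨2, by omega⟩ g h rfl rfl rfl hg hh hA1 hA2 α
  have g0 : 3 ≤ (⟨3, by omega⟩ : Fin (a + b + 3)).val ∧
      (⟨3, by omega⟩ : Fin (a + b + 3)).val ≤ a + 2 := by
    dsimp only; omega
  have h0 : a + 3 ≤ (⟨a + 3, by omega⟩ : Fin (a + b + 3)).val := le_refl _
  constructor
  · intro hp
    ext α
    constructor
    · intro hα
      by_contra hcon
      simp only [Set.mem_union, Set.mem_setOf_eq, not_or] at hcon
      obtain ⟨c1, c2⟩ := hcon
      push Not at c1 c2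
      obtain ⟨g, hg1, hg2, hg3⟩ := c1
      obtain ⟨h, hh1, hh2⟩ := c2
      exact (key g h ⟨hg1, hg2⟩ hh1 α).2.2.2 hp hg3 hh2 hα
    · rintro (hα | hα)
      · exact (key _ _ g0 h0 α).2.1 hp hα
      · exact (key _ _ g0 h0 α).2.2.1 hp hα
  · intro hp
    ext α
    simp only [Set.mem_univ, iff_true]
    exact (key _ _ g0 h0 α).1 hp
end
end
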